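/- arXiv:1804.07109 — 2 statements merged into one kernel-verified Lean document; each statement's English description precedes it below -/
import Mathlib

section
/- Let K₁ be the subfield of ℂ generated over ℚ by the real fourth root 2^{1/4} of 2 and by ζ₈ = exp(2πi/8). Then the set {(x, y) ∈ K₁ × K₁ | x⁴ + y⁴ = 1} has exactly 56 elements. -/
open Complex Real


lemma fq_descent : ∀ (N : ℕ) (a b w : ℤ), (a * b).natAbs = N → a ≠ 0 → b ≠ 0 →
    a ^ 4 + 4 * b ^ 4 ≠ w ^ 2 := by
  intro N
  induction N using Nat.strong_induction_on with
  | _ N IH =>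
  intro a b w hN ha hb h
  -- smaller instance helper
  have small : ∀ a' b' w' : ℤ, a' ≠ 0 → b' ≠ 0 → (a' * b').natAbs < (a * b).natAbs →
      a' ^ 4 + 4 * b' ^ 4 ≠ w' ^ 2 := fun a' b' w' h1 h2 h3 =>
    IH _ (hN ▸ h3) a' b' w' rfl h1 h2
  by_cases hg : Int.gcd a b = 1
  swap
  · obtain ⟨a', ha'⟩ := Int.gcd_dvd_left a b
    obtain ⟨b', hb'⟩ := Int.gcd_dvd_right a b
    set g : ℤ := (Int.gcd a b : ℤ) with hgdef
    have hg0 : Int.gcd a b ≠ 0 := by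
      intro h0; exact ha (Int.gcd_eq_zero_iff.mp h0).1
    have hg2 : 2 ≤ g := by rw [hgdef]; omega
    have ha0 : a' ≠ 0 := by rintro rfl; simp at ha'; exact ha ha'
    have hb0 : b' ≠ 0 := by rintro rfl; simp at hb'; exact hb hb'
    have hd : (g ^ 2) ^ 2 ∣ w ^ 2 := ⟨a' ^ 4 + 4 * b' ^ 4, by rw [← h, ha', hb']; ring⟩
    rw [Int.pow_dvd_pow_iff (by norm_num)] at hd
    obtain ⟨w', hw'⟩ := hd
    refine small a' b' w' ha0 hb0 ?_ ?_
    · rw [ha', hb', show g * a' * (g * b') = (g * g) * (a' * b') by ring, Int.natAbs_mul (g*g)]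
      have : 0 < (a' * b').natAbs := Int.natAbs_pos.mpr (mul_ne_zero ha0 hb0)
      have : 2 ≤ (g * g).natAbs := by
        have : 2 ≤ g * g := by nlinarith
        omega
      nlinarith
    · have : g ^ 4 * (a' ^ 4 + 4 * b' ^ 4) = g ^ 4 * w' ^ 2 := by
        rw [hw', ha', hb'] at h; linarith
      exact mul_left_cancel₀ (by positivity) this
  rcases Int.emod_two_eq_zero_or_one a with hp | hp
  · obtain ⟨c, rfl⟩ : (2 : ℤ) ∣ a := Int.dvd_of_emod_eq_zero hp
    have hd : 2 ^ 2 ∣ w ^ 2 := ⟨4 * c ^ 4 + b ^ 4, by rw [← h]; ring⟩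
    rw [Int.pow_dvd_pow_iff (by norm_num)] at hd
    obtain ⟨w', rfl⟩ := hd
    have hc : c ≠ 0 := by rintro rfl; simp at ha
    refine small b c w' hb hc ?_ (by linarith)
    have : 0 < (c * b).natAbs := Int.natAbs_pos.mpr (mul_ne_zero hc hb)
    rw [mul_assoc, Int.natAbs_mul 2, mul_comm b c]
    simp only [Int.reduceAbs] at *
    omega
  · have hw0 : w ≠ 0 := by
      rintro rfl
      have : 0 < a ^ 4 := by positivity
      have : 0 < b ^ 4 := by positivity
      linarith
    have hab2 : IsCoprime a (2 * b) := by
      refine IsCoprime.mul_right ?_ (Int.isCoprime_iff_gcd_eq_one.mpr hg)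
      exact ⟨1, -(a / 2), by have := Int.emod_add_mul_ediv a 2; linarith⟩
    have hT : PythagoreanTriple (a ^ 2) (2 * b ^ 2) |w| := by
      unfold PythagoreanTriple
      rw [abs_mul_abs_self]; linear_combination h
    have hab : IsCoprime (a ^ 2) (2 * b ^ 2) := by
      have h1 : IsCoprime a 2 := hab2.of_mul_right_left
      have h2 : IsCoprime a b := hab2.of_mul_right_right
      exact IsCoprime.mul_right h1.pow_left (h2.pow)
    have hodd : a ^ 2 % 2 = 1 := by
      rw [pow_two, Int.mul_emod, hp]; norm_num
    obtain ⟨m, n, h1, h2, h3, h4, h5, h6⟩ := hT.coprime_classification'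
      (Int.isCoprime_iff_gcd_eq_one.mp hab) hodd (abs_pos.mpr hw0)
    have hmn : m * n = b ^ 2 := by linarith
    have hb2 : 0 < b ^ 2 := by positivity
    have hm : 0 < m := by
      rcases h6.lt_or_eq with h | h
      · exact h
      · rw [← h] at hmn; linarith
    have hn : 0 < n := by
      by_contra hh
      nlinarith
    obtain ⟨p, hp'⟩ := Int.sq_of_gcd_eq_one h4 hmn
    obtain ⟨q, hq'⟩ := Int.sq_of_gcd_eq_one (Int.gcd_comm m n ▸ h4) (mul_comm m n ▸ hmn)
    replace hp' : m = p ^ 2 := hp'.resolve_right (by nlinarith [sq_nonneg p])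
    replace hq' : n = q ^ 2 := hq'.resolve_right (by nlinarith [sq_nonneg q])
    subst hp' hq'
    have hT2 : PythagoreanTriple a (q ^ 2) (p ^ 2) := by
      unfold PythagoreanTriple; linear_combination h1
    have hc2 : IsCoprime a (q ^ 2) := by
      have hc := Int.isCoprime_iff_gcd_eq_one.mpr h4
      have : IsCoprime (a ^ 2) (q ^ 2) := by
        rw [h1, show (p^2)^2 - (q^2)^2 = (p^2)^2 + q^2 * (-q^2) by ring]
        exact (hc.pow_left).add_mul_left_left _
      exact (IsCoprime.pow_left_iff (by norm_num)).mp this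
    obtain ⟨M, N', k1, k2, k3, k4, k5, k6⟩ := hT2.coprime_classification'
      (Int.isCoprime_iff_gcd_eq_one.mp hc2) hp (by positivity)
    have fin : ∀ X Y : ℤ, 0 < X * Y → q ^ 2 = 4 * X * Y → p ^ 2 = 4 * X ^ 2 + Y ^ 2 → Int.gcd X Y = 1 →
        0 < X → False := by
      intro X Y hXY hq hpp hco hX
      have hY : 0 < Y := by by_contra hh; nlinarith
      have hd : 2 ^ 2 ∣ q ^ 2 := ⟨X * Y, by rw [hq]; ring⟩
      rw [Int.pow_dvd_pow_iff (by norm_num)] at hd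
      obtain ⟨q', rfl⟩ := hd
      have hq2 : X * Y = q' ^ 2 := by linarith
      obtain ⟨f, hf⟩ := Int.sq_of_gcd_eq_one hco hq2
      obtain ⟨e, he⟩ := Int.sq_of_gcd_eq_one (Int.gcd_comm X Y ▸ hco) (mul_comm X Y ▸ hq2)
      replace hf : X = f ^ 2 := hf.resolve_right (by nlinarith [sq_nonneg f])
      replace he : Y = e ^ 2 := he.resolve_right (by nlinarith [sq_nonneg e])
      subst hf he
      have hf0 : f ≠ 0 := by rintro rfl; simp at hX
      have he0 : e ≠ 0 := by rintro rfl; simp at hY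
      refine small e f p he0 hf0 ?_ (by rw [hpp]; ring)
      rw [Int.natAbs_lt_iff_sq_lt]
      have e1 : (a * b) ^ 2 = a ^ 2 * (p ^ 2 * (4 * (e * f) ^ 2)) := by
        rw [mul_pow, ← hmn]; linear_combination 4 * a^2 * p^2 * (-hq2)
      rw [e1]
      have i1 : 1 ≤ a ^ 2 := by have : 0 < a ^ 2 := by positivity
                                omega
      have i2 : 1 ≤ p ^ 2 := hm
      have i3 : 0 < (e * f) ^ 2 := by positivity
      have i4 : 1 ≤ a ^ 2 * p ^ 2 := one_le_mul_of_one_le_of_one_le i1 i2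
      have i5 := mul_le_mul_of_nonneg_right i4 (by linarith : 0 ≤ 4 * (e * f) ^ 2)
      have i6 : a ^ 2 * (p ^ 2 * (4 * (e * f) ^ 2)) = a ^ 2 * p ^ 2 * (4 * (e * f) ^ 2) := by ring
      rw [i6]
      linarith
    have hMN : 0 < 2 * M * N' := by rw [← k2]; positivity
    have hM : 0 < M := by
      rcases k6.lt_or_eq with h | h
      · exact h
      · rw [← h] at hMN; simp at hMN
    have hN' : 0 < N' := by by_contra hh; nlinarith
    rcases k5 with ⟨k5, k5'⟩ | ⟨k5, k5'⟩
    · obtain ⟨X, rfl⟩ : (2 : ℤ) ∣ M := Int.dvd_of_emod_eq_zero k5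
      have hX : 0 < X := by linarith
      refine fin X N' (by positivity) (by rw [k2]; ring) (by rw [k3]; ring) ?_ hX
      have := (Int.isCoprime_iff_gcd_eq_one.mpr k4).of_mul_left_right
      exact Int.isCoprime_iff_gcd_eq_one.mp this
    · obtain ⟨X, rfl⟩ : (2 : ℤ) ∣ N' := Int.dvd_of_emod_eq_zero k5'
      have hX : 0 < X := by linarith
      refine fin X M (by positivity) (by rw [k2]; ring) (by rw [k3]; ring) ?_ hX
      have := (Int.isCoprime_iff_gcd_eq_one.mpr k4).of_mul_right_right
      exact Int.isCoprime_iff_gcd_eq_one.mp this.symm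

/-- rational points of v^2 = 1 + 4u^4 -/
lemma fq_rat1 (u v : ℚ) (h : v ^ 2 = 1 + 4 * u ^ 4) : u = 0 := by
  by_contra hu
  have hs : IsSquare (((u.den : ℤ) ^ 4 + 4 * u.num ^ 4 : ℤ) : ℚ) := by
    refine ⟨v * u.den ^ 2, ?_⟩
    have hd : (u.den : ℚ) ≠ 0 := by exact_mod_cast u.den_ne_zero
    have : u * u.den = u.num := Rat.mul_den_eq_num u
    push_cast
    rw [← this]
    linear_combination (-(u.den:ℚ)^4) * h
  rw [Rat.isSquare_intCast_iff] at hs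
  obtain ⟨w, hw⟩ := hs
  exact fq_descent _ u.den u.num w rfl (by exact_mod_cast u.den_ne_zero) (by simpa using hu)
    (by rw [hw]; ring)

lemma fq_rat2 (u v : ℚ) (h : v ^ 2 = 1 + u ^ 4) : u = 0 := by
  by_contra hu
  have hs : IsSquare (((u.den : ℤ) ^ 4 + u.num ^ 4 : ℤ) : ℚ) := by
    refine ⟨v * u.den ^ 2, ?_⟩
    have hd : (u.den : ℚ) ≠ 0 := by exact_mod_cast u.den_ne_zero
    have : u * u.den = u.num := Rat.mul_den_eq_num u
    push_cast
    rw [← this]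
    linear_combination (-(u.den:ℚ)^4) * h
  rw [Rat.isSquare_intCast_iff] at hs
  obtain ⟨w, hw⟩ := hs
  exact not_fermat_42 (a := u.den) (b := u.num) (c := w) (by exact_mod_cast u.den_ne_zero) (by simpa using hu)
    (by rw [hw]; ring)

lemma fq_E1_rat (x y : ℚ) (h : y ^ 2 = x ^ 3 - x) : y = 0 := by
  by_cases hx : x = 0
  · subst hx; simpa using h
  have := fq_rat1 (y / (2 * x)) (2 * (x / 2 - (y / (2 * x)) ^ 2)) (by
    field_simp
    linear_combination (-16 * x^3)*h)
  simpa [hx] using this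

lemma fq_E2_rat (x y : ℚ) (h : y ^ 2 = x ^ 3 - 4 * x) : y = 0 := by
  by_cases hx : x = 0
  · subst hx; simpa using h
  have := fq_rat2 (y / (2 * x)) (x / 2 - (y / (2 * x)) ^ 2) (by
    field_simp
    linear_combination (-4 * x^3)*h)
  simpa [hx] using this


section ec
open WeierstrassCurve WeierstrassCurve.Affine

def fqW : WeierstrassCurve.Affine ℚ := ⟨0, 0, 0, -1, 0⟩

variable {L : Type*} [Field L] [CharZero L]

lemma fq_eqn (x y : L) : (fqW⁄L).Equation x y ↔ y ^ 2 = x ^ 3 - x := by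
  rw [WeierstrassCurve.Affine.equation_iff]
  simp [fqW, sub_eq_add_neg]

lemma fq_negY (x y : L) : (fqW⁄L).negY x y = - y := by
  simp [fqW, WeierstrassCurve.Affine.negY]

lemma fq_nonsing (x y : L) : (fqW⁄L).Nonsingular x y ↔ y ^ 2 = x ^ 3 - x := by
  rw [WeierstrassCurve.Affine.nonsingular_iff, fq_eqn]
  simp only [fqW, WeierstrassCurve.Affine.baseChange]
  constructor
  · exact fun h => h.1
  · intro h
    refine ⟨h, ?_⟩
    by_contra hh
    simp at hh
    grind

variable [DecidableEq L]

lemma fq_two_zero {x y : L} (h : (fqW⁄L).Nonsingular x y) (hy : y = 0) :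
    2 • (Point.some x y h) = 0 := by
  rw [two_smul]
  exact Point.add_self_of_Y_eq (by rw [fq_negY, hy, neg_zero])

lemma fq_two {x y : L} (h : (fqW⁄L).Nonsingular x y) (hy : y ≠ 0) :
    ∃ (Y : L) (h' : (fqW⁄L).Nonsingular (((x ^ 2 + 1) / (2 * y)) ^ 2) Y), 2 • (Point.some x y h) = Point.some (((x ^ 2 + 1) / (2 * y)) ^ 2) Y h' := by
  have hne : y ≠ (fqW⁄L).negY x y := by
    rw [fq_negY]; intro hh; apply hy; grind
  have e := (fq_nonsing x y).mp h
  have hX : (fqW⁄L).addX x x ((fqW⁄L).slope x x y y) = ((x ^ 2 + 1) / (2 * y)) ^ 2 := by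
    rw [WeierstrassCurve.Affine.slope_of_Y_ne rfl hne, fq_negY]
    simp only [fqW, WeierstrassCurve.Affine.addX, WeierstrassCurve.Affine.baseChange]
    simp
    have : y + y ≠ 0 := by intro hh; apply hy; grind
    field_simp
    grind
  rw [two_smul, Point.add_self_of_Y_ne hne]
  generalize ((x ^ 2 + 1) / (2 * y)) ^ 2 = z at *
  subst hX
  exact ⟨_, _, rfl⟩

/-- the coordinate form of 4-torsion -/
def FqTor (x y : L) : Prop := y = 0 ∨ x ^ 2 = -1 ∨ x ^ 2 - 2 * x - 1 = 0 ∨ x ^ 2 + 2 * x - 1 = 0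

lemma fq_two_inv {x y : L} (h : (fqW⁄L).Nonsingular x y) (h2 : 2 • (Point.some x y h) = 0) : y = 0 := by
  by_contra hy
  obtain ⟨Y, h', e⟩ := fq_two h hy
  rw [e] at h2
  exact Point.some_ne_zero _ h2

lemma fq_half {x y : L} (e : y ^ 2 = x ^ 3 - x) (hy : y ≠ 0) {X Y : L} (hX : X = ((x ^ 2 + 1) / (2 * y)) ^ 2)
    (hE : Y ^ 2 = X ^ 3 - X) : Y = 0 ↔ (x ^ 2 = -1 ∨ x ^ 2 - 2 * x - 1 = 0 ∨ x ^ 2 + 2 * x - 1 = 0) := by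
  have e0 : X * (2 * y) ^ 2 = (x ^ 2 + 1) ^ 2 := by rw [hX]; field_simp
  have e1 : (X - 1) * (2 * y) ^ 2 = (x ^ 2 - 2 * x - 1) ^ 2 := by linear_combination e0 - 4 * e
  have e2 : (X + 1) * (2 * y) ^ 2 = (x ^ 2 + 2 * x - 1) ^ 2 := by linear_combination e0 + 4 * e
  have hy2 : (2 * y) ^ 2 ≠ 0 := by simp [hy]
  constructor
  · intro hY
    have : X * ((X - 1) * (X + 1)) = 0 := by rw [hY] at hE; linear_combination -hE
    rcases mul_eq_zero.mp this with h | h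
    · left; rw [h, zero_mul] at e0
      have := pow_eq_zero_iff (two_ne_zero) |>.mp e0.symm
      linear_combination this
    rcases mul_eq_zero.mp h with h | h
    · right; left; rw [h, zero_mul] at e1
      exact pow_eq_zero_iff (two_ne_zero) |>.mp e1.symm
    · right; right; rw [h, zero_mul] at e2
      exact pow_eq_zero_iff (two_ne_zero) |>.mp e2.symm
  · intro h
    have : X * (X - 1) * (X + 1) = 0 := by
      rcases h with h | h | h
      · have : X = 0 := by
          rw [h] at e0; simpa [hy2, hy] using e0
        rw [this]; ring
      · have : X - 1 = 0 := by
          rw [h] at e1; simpa [hy2, hy] using e1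
        rw [this]; ring
      · have : X + 1 = 0 := by
          rw [h] at e2; simpa [hy2, hy] using e2
        rw [this]; ring
    have : Y ^ 2 = 0 := by rw [hE]; linear_combination this
    simpa using this

lemma fq_four {x y : L} (h : (fqW⁄L).Nonsingular x y) : 4 • (Point.some x y h) = 0 ↔ FqTor x y := by
  have e := (fq_nonsing x y).mp h
  by_cases hy : y = 0
  · rw [show (4 : ℕ) = 2 * 2 from rfl, mul_smul, fq_two_zero h hy]
    simp [FqTor, hy]
  · obtain ⟨Y, h', e2⟩ := fq_two h hy
    rw [show (4 : ℕ) = 2 * 2 from rfl, mul_smul, e2]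
    have e' := (fq_nonsing _ _).mp h'
    have := fq_half e hy rfl e'
    rw [FqTor]
    simp only [hy, false_or]
    rw [← this]
    exact ⟨fq_two_inv _, fq_two_zero _⟩

lemma fq_eight (n1 : ∀ x u : L, x ^ 2 = -1 → u ^ 2 ≠ x - 1)
    (n2 : ∀ x u : L, x ^ 2 - 2 * x - 1 = 0 → u ^ 2 ≠ x)
    (n3 : ∀ x u : L, x ^ 2 + 2 * x - 1 = 0 → u ^ 2 ≠ x)
    {x y : L} (h : (fqW⁄L).Nonsingular x y) (h8 : 8 • (Point.some x y h) = 0) : FqTor x y := by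
  by_cases hy : y = 0
  · exact Or.inl hy
  have e := (fq_nonsing x y).mp h
  obtain ⟨Y, h', e2⟩ := fq_two h hy
  have e' := (fq_nonsing _ _).mp h'
  rw [show (8 : ℕ) = 4 * 2 from rfl, mul_smul, e2, fq_four] at h8
  rcases h8 with h8 | h8 | h8 | h8
  · exact Or.inr ((fq_half e hy rfl e').mp h8)
  · refine absurd ?_ (n1 _ ((x ^ 2 - 2 * x - 1) / (2 * y)) h8)
    field_simp
    linear_combination 4 * e
  · exact absurd rfl (n2 _ _ h8)
  · exact absurd rfl (n3 _ _ h8)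

lemma fq_galois (σ : L →+* L) (hσ : ∀ z, σ (σ z) = z) (n : ℕ)
    (H : ∀ (x y : L) (h : (fqW⁄L).Nonsingular x y), σ x = x → (σ y = y ∨ σ y = - y) →
      n • (Point.some x y h) = 0) (P : (fqW⁄L).Point) : (n * 2) • P = 0 := by
  let s : L →ₐ[ℚ] L := σ.toRatAlgHom
  have hs : ∀ z, s z = σ z := fun _ => rfl
  let S : (fqW⁄L).Point →+ (fqW⁄L).Point := Point.map s
  have hS : ∀ Q, S (S Q) = Q := by
    intro Q
    rcases Q with _ | ⟨x, y, h⟩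
    · rfl
    · simp only [S, Point.map_some, hs, hσ]
  have H1 : ∀ Q, (S Q = Q ∨ S Q = - Q) → n • Q = 0 := by
    intro Q hQ
    rcases Q with _ | ⟨x, y, h⟩
    · exact smul_zero n
    · simp only [S, Point.map_some, Point.neg_some, Point.some.injEq, hs, fq_negY] at hQ
      exact H x y h (by tauto) (by tauto)
  have e : (2 : ℕ) • P = (P + S P) + (P - S P) := by rw [two_smul]; abel
  rw [mul_smul, e, smul_add, H1 (P + S P) (Or.inl (by rw [map_add, hS, add_comm])),
    H1 (P - S P) (Or.inr (by rw [map_sub, hS, neg_sub])), add_zero]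

end ec


set_option maxHeartbeats 2000000 in
lemma fq_cases {k : Type*} [Field k] [CharZero k] (i r : k) (hi : i ^ 2 = -1) (hr : r ^ 2 = 2)
    (nr : ∀ u : k, u ^ 2 ≠ r) (n7 : ∀ u : k, u ^ 2 ≠ 7 * r) (n3 : ∀ u : k, u ^ 2 ≠ 3)
    (n3r : ∀ u : k, u ^ 2 ≠ 3 * r)
    (nh : ∀ R u : k, R ^ 2 = 2 → u ^ 2 ≠ 1 + R)
    (n13 : ∀ R u : k, R ^ 2 = 2 → u ^ 2 ≠ 13 + 9 * R)
    (n3i : ∀ N u : k, N ^ 2 = -1 → u ^ 2 ≠ 3 + N)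
    (B C d : k) (hd : d ≠ 0) (hD : B ^ 2 - 4 * C = r * d ^ 2)
    (h2 : C = 1 ∨ (∃ j, j ^ 2 = -1 ∧ C = -1 - j * B) ∨ (∃ e, e ^ 2 = 1 ∧ (e * B + C + 1) ^ 2 = 8 * C) ∨
      (∃ j R, j ^ 2 = -1 ∧ R ^ 2 = 2 ∧ ((1 + R) * j * B + C + 1) ^ 2 = -8 * (1 + R) * C))
    (h3 : C = -1 ∨ (∃ e, e ^ 2 = 1 ∧ C = 1 - e * B) ∨ (∃ j, j ^ 2 = -1 ∧ (1 - C - j * B) ^ 2 = -8 * C) ∨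
      (∃ e R, e ^ 2 = 1 ∧ R ^ 2 = 2 ∧ ((1 + R) * e * B + C - 1) ^ 2 = 8 * (1 + R) * C)) :
    False := by
  have h20 : (2 : k) ≠ 0 := two_ne_zero
  have hsq : ∀ w, B ^ 2 - 4 * C ≠ w ^ 2 := by
    intro w hw
    apply nr (w / d)
    field_simp
    rw [← hw, hD]; ring
  have h7 : ∀ w, B ^ 2 - 4 * C ≠ 7 * w ^ 2 := by
    intro w hw
    by_cases hw0 : w = 0
    · exact hsq 0 (by rw [hw, hw0]; ring)
    apply n7 (r * d / w)
    field_simp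
    linear_combination r * (hw - hD)
  have h3r : ∀ w, B ^ 2 - 4 * C ≠ 3 * w ^ 2 := by
    intro w hw
    by_cases hw0 : w = 0
    · exact hsq 0 (by rw [hw, hw0]; ring)
    apply n3r (r * d / w)
    field_simp
    linear_combination r * (hw - hD)
  have hh : ∀ R u w : k, R ^ 2 = 2 → u ^ 2 = (1 + R) * w ^ 2 → w = 0 := by
    intro R u w hR h
    by_contra hw
    apply nh R (u / w) hR
    field_simp
    linear_combination h
  have hi0 : i ≠ 0 := by rintro rfl; norm_num at hi
  have hR0 : ∀ R : k, R ^ 2 = 2 → R ≠ 0 := by rintro R h rfl; norm_num at h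
  have hC0 : C ≠ 0 := by
    rintro rfl; exact hsq B (by ring)
  have pm : ∀ a b : k, a ^ 2 = b ^ 2 → a = b ∨ a = - b := fun a b h => sq_eq_sq_iff_eq_or_eq_neg.mp h
  rcases h2 with rfl | ⟨j, hj, rfl⟩ | ⟨e, he, h2⟩ | ⟨j, R, hj, hR, h2⟩
  · rcases h3 with h3 | ⟨e', he', h3⟩ | ⟨j', hj', h3⟩ | ⟨e', R', he', hR', h3⟩
    · norm_num [eq_neg_iff_add_eq_zero] at h3
    · apply hsq (2 * i)
      have : B = 0 := by (clear nr n7 n3 n3r nh n13 n3i hsq h7 h3r hh hR0 pm hD hd; grind)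
      (clear nr n7 n3 n3r nh n13 n3i hsq h7 h3r hh hR0 pm hD hd; grind)
    · apply hsq 2
      (clear nr n7 n3 n3r nh n13 n3i hsq h7 h3r hh hR0 pm hD hd; grind)
    · refine mul_ne_zero h20 (hR0 R' hR') (hh R' ((1 + R') * B) (2 * R') hR' ?_)
      (clear nr n7 n3 n3r nh n13 n3i hsq h7 h3r hh hR0 pm hD hd; grind)
  · rcases h3 with h3 | ⟨e', he', h3⟩ | ⟨j', hj', h3⟩ | ⟨e', R', he', hR', h3⟩
    · apply hsq 2
      have : B = 0 := by (clear nr n7 n3 n3r nh n13 n3i hsq h7 h3r hh hR0 pm hD hd; grind)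
      (clear nr n7 n3 n3r nh n13 n3i hsq h7 h3r hh hR0 pm hD hd; grind)
    · apply h3r (e' + j)
      have : B = e' + j := by (clear nr n7 n3 n3r nh n13 n3i hsq h7 h3r hh hR0 pm hD hd; grind)
      rw [this]
      linear_combination 2 * hj - 2 * he'
    · rcases pm j' j (by rw [hj, hj']) with rfl | rfl
      · apply h7 (1/2)
        have : j' * B = - 1 / 2 := by (clear nr n7 n3 n3r nh n13 n3i hsq h7 h3r hh hR0 pm hD hd; grind)
        (clear nr n7 n3 n3r nh n13 n3i hsq h7 h3r hh hR0 pm hD hd; grind)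
      · have : (j * B - 1) * (j * B + 1) = 0 := by (clear nr n7 n3 n3r nh n13 n3i hsq h7 h3r hh hR0 pm hD hd; grind)
        rcases mul_eq_zero.mp this with h | h
        · apply h7 1
          (clear nr n7 n3 n3r nh n13 n3i hsq h7 h3r hh hR0 pm hD hd; grind)
        · apply hsq B
          (clear nr n7 n3 n3r nh n13 n3i hsq h7 h3r hh hR0 pm hD hd; grind)
    · have := hh R' ((1 - j * e') * (e' * B) + (j * e') * (1 + R') - 1) (2 * i) hR' (by
        have hq : (1 - j * e') * (e' * B) ^ 2 + 2 * ((j * e') * (1 + R') - 1) * (e' * B) + 2 * (1 + R') = 0 := by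
          (clear nr n7 n3 n3r nh n13 n3i hsq h7 h3r hh hR0 pm hD hd; grind)
        (clear nr n7 n3 n3r nh n13 n3i hsq h7 h3r hh hR0 pm hD hd; grind))
      (clear nr n7 n3 n3r nh n13 n3i hsq h7 h3r hh hR0 pm hD hd; grind)
  · rcases h3 with rfl | ⟨e', he', rfl⟩ | ⟨j', hj', h3⟩ | ⟨e', R', he', hR', h3⟩
    · apply hsq (2 * i)
      (clear nr n7 n3 n3r nh n13 n3i hsq h7 h3r hh hR0 pm hD hd; grind)
    · rcases pm e' e (by rw [he, he']) with rfl | rfl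
      · apply h7 (i/2)
        have : e' * B = 1 / 2 := by (clear nr n7 n3 n3r nh n13 n3i hsq h7 h3r hh hR0 pm hD hd; grind)
        (clear nr n7 n3 n3r nh n13 n3i hsq h7 h3r hh hR0 pm hD hd; grind)
      · have : (e * B - 1) * (e * B + 1) = 0 := by (clear nr n7 n3 n3r nh n13 n3i hsq h7 h3r hh hR0 pm hD hd; grind)
        rcases mul_eq_zero.mp this with h | h
        · apply h7 i
          (clear nr n7 n3 n3r nh n13 n3i hsq h7 h3r hh hR0 pm hD hd; grind)
        · apply hsq B
          (clear nr n7 n3 n3r nh n13 n3i hsq h7 h3r hh hR0 pm hD hd; grind)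
    · obtain ⟨n, hn⟩ : ∃ n, n = j' * e := ⟨_, rfl⟩
      obtain ⟨y, hy⟩ : ∃ y, y = e * B := ⟨_, rfl⟩
      have hn2 : n ^ 2 = -1 := by (clear nr n7 n3 n3r nh n13 n3i hsq h7 h3r hh hR0 pm hD hd; grind)
      have hjB : j' * B = n * y := by (clear nr n7 n3 n3r nh n13 n3i hsq h7 h3r hh hR0 pm hD hd; grind)
      have hB2 : B ^ 2 = y ^ 2 := by (clear nr n7 n3 n3r nh n13 n3i hsq h7 h3r hh hR0 pm hD hd; grind)
      rw [← hy] at h2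
      rw [hjB] at h3
      rcases pm (1 - C - n * y) (n * (y + C + 1)) (by (clear nr n7 n3 n3r nh n13 n3i hsq h7 h3r hh hR0 pm hD hd; grind)) with h | h
      · have h5 : C ^ 2 + 14 * n * C - 1 = 0 := by (clear nr n7 n3 n3r nh n13 n3i hsq h7 h3r hh hR0 pm hD hd; grind)
        apply n3 (n * (C + 7 * n) / 4)
        (clear nr n7 n3 n3r nh n13 n3i hsq h7 h3r hh hR0 pm hD hd; grind)
      · have hC : C = n := by (clear nr n7 n3 n3r nh n13 n3i hsq h7 h3r hh hR0 pm hD hd; grind)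
        subst hC
        rcases pm (y + C + 1) (2 * (1 + C)) (by (clear nr n7 n3 n3r nh n13 n3i hsq h7 h3r hh hR0 pm hD hd; grind)) with h | h
        · apply hsq (1 - C); (clear nr n7 n3 n3r nh n13 n3i hsq h7 h3r hh hR0 pm hD hd; grind)
        · apply h7 (1 + C); (clear nr n7 n3 n3r nh n13 n3i hsq h7 h3r hh hR0 pm hD hd; grind)
    · have := hh R' _ _ hR' (show ((1 + R') * e' * B + C - 1) ^ 2 = (1 + R') * (e * B + C + 1) ^ 2 by rw [h2, h3]; ring)
      rw [this] at h2
      apply hC0; (clear nr n7 n3 n3r nh n13 n3i hsq h7 h3r hh hR0 pm hD hd; grind)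
  · have hh0 : (1 + R) * (R - 1) = 1 := by linear_combination hR
    rcases h3 with rfl | ⟨e', he', rfl⟩ | ⟨j', hj', h3⟩ | ⟨e', R', he', hR', h3⟩
    · have := hh R ((1 + R) * B) (2 * R * i) hR (by (clear nr n7 n3 n3r nh n13 n3i hsq h7 h3r hh hR0 pm hD hd; grind))
      (clear nr n7 n3 n3r nh n13 n3i hsq h7 h3r hh hR0 pm hD hd; grind)
    · have := hh R ((1 + j * e') * (e' * B) + (1 + R) - j * e') 2 hR (by
        have hq : (1 + j * e') * (e' * B) ^ 2 + 2 * ((1 + R) - j * e') * (e' * B) - 2 * (1 + R) = 0 := by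
          (clear nr n7 n3 n3r nh n13 n3i hsq h7 h3r hh hR0 pm hD hd; grind)
        (clear nr n7 n3 n3r nh n13 n3i hsq h7 h3r hh hR0 pm hD hd; grind))
      (clear nr n7 n3 n3r nh n13 n3i hsq h7 h3r hh hR0 pm hD hd; grind)
    · have := hh R _ _ hR (show _ = (1 + R) * (1 - C - j' * B) ^ 2 by rw [h2, h3]; ring)
      rw [this] at h3
      apply hC0; (clear nr n7 n3 n3r nh n13 n3i hsq h7 h3r hh hR0 pm hD hd; grind)
    · obtain ⟨n, hn⟩ : ∃ n, n = j * e' := ⟨_, rfl⟩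
      obtain ⟨y, hy⟩ : ∃ y, y = e' * B := ⟨_, rfl⟩
      have hn2 : n ^ 2 = -1 := by (clear nr n7 n3 n3r nh n13 n3i hsq h7 h3r hh hR0 pm hD hd; grind)
      have hjB : j * B = n * y := by (clear nr n7 n3 n3r nh n13 n3i hsq h7 h3r hh hR0 pm hD hd; grind)
      rw [mul_assoc, ← hy] at h3
      rw [mul_assoc (1 + R) j, hjB] at h2
      rcases pm R' R (by rw [hR, hR']) with rfl | rfl
      · rcases pm ((1 + R') * (n * y) + C + 1) (n * ((1 + R') * y + C - 1)) (by
          linear_combination h2 + h3 - ((1 + R') * y + C - 1) ^ 2 * hn2) with h | h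
        · have hC : C = - n := by (clear nr n7 n3 n3r nh n13 n3i hsq h7 h3r hh hR0 pm hD hd; grind)
          subst hC
          have := hh R' _ (2 * (1 - n)) hR (h3.trans (by (clear nr n7 n3 n3r nh n13 n3i hsq h7 h3r hh hR0 pm hD hd; grind)))
          (clear nr n7 n3 n3r nh n13 n3i hsq h7 h3r hh hR0 pm hD hd; grind)
        · have h5 : C ^ 2 + n * (2 + 16 * (1 + R')) * C - 1 = 0 := by
            have : 2 * n * (1 + R') * y = - n * (C - 1) - C - 1 := by linear_combination h
            have h6 : 2 * ((1 + R') * y + C - 1) = C * (1 + n) - (1 - n) := by (clear nr n7 n3 n3r nh n13 n3i hsq h7 h3r hh hR0 pm hD hd; grind)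
            have h77 : (C * (1 + n) - (1 - n)) ^ 2 = 32 * (1 + R') * C := by
              rw [← h6]; linear_combination 4 * h3
            (clear nr n7 n3 n3r nh n13 n3i hsq h7 h3r hh hR0 pm hD hd; grind)
          apply n13 R' (i * (C + n * (1 + 8 * (1 + R'))) / 4) hR
          linear_combination (i ^ 2 / 16) * (h5 + (1 + 8 * (1 + R')) ^ 2 * hn2) - (1 + R') * (1 + 4 * (1 + R')) * hi + 4 * hR
      · obtain ⟨h, hhd⟩ : ∃ h, h = 1 + R := ⟨_, rfl⟩
        have hhs : h ^ 2 = 1 + 2 * h := by (clear nr n7 n3 n3r nh n13 n3i hsq h7 h3r hh hR0 pm hD hd; grind)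
        have h3' : (-y + h * C - h) ^ 2 = -8 * h * C := by (clear nr n7 n3 n3r nh n13 n3i hsq h7 h3r hh hR0 pm hD hd; grind)
        rw [← hhd] at h2
        obtain ⟨m, hm, hm'⟩ : ∃ m : k, m ^ 2 = 1 ∧ h * (n * y) + C + 1 = m * (-y + h * C - h) := by
          rcases pm _ _ (h2.trans h3'.symm) with h | h
          · exact ⟨1, by ring, by rw [h]; ring⟩
          · exact ⟨-1, by ring, by rw [h]; ring⟩
        have k1 : (-y + h * C - h) * (h * n + m) = C * (1 + h ^ 2 * n) + (1 - h ^ 2 * n) := by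
          linear_combination (-1) * hm' 
        have k2 : (C * (1 + h ^ 2 * n) + (1 - h ^ 2 * n)) ^ 2 = -8 * h * C * (h * n + m) ^ 2 := by
          rw [← k1, mul_pow, h3']
        have k3 : (h * n + m) ^ 2 = -2 * h * (1 - n * m) := by linear_combination h ^ 2 * hn2 + hm - hhs
        have k4 : (1 + h ^ 2 * n) ^ 2 = h ^ 2 * (- 4 * R + 2 * n) := by linear_combination h ^ 4 * hn2 - (h ^ 2 - 2 * h + 1) * hhs - 4 * h ^ 2 * hhd
        have k5 : (1 - h ^ 2 * n) ^ 2 = h ^ 2 * (- 4 * R - 2 * n) := by linear_combination h ^ 4 * hn2 - (h ^ 2 - 2 * h + 1) * hhs - 4 * h ^ 2 * hhd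
        have k6 : (1 + h ^ 2 * n) * (1 - h ^ 2 * n) = 6 * h ^ 2 := by linear_combination -h ^ 4 * hn2 + (h ^ 2 + 2 * h - 1) * hhs
        have h0 : h ≠ 0 := by rintro rfl; norm_num at hhs
        have k7 : h ^ 2 * (2 * ((n - 2 * R) * C ^ 2 + (-2 + 8 * (n * m)) * C - (2 * R + n))) = 0 := by
          rw [k3] at k2
          linear_combination k2 - C ^ 2 * k4 - k5 - 2 * C * k6
        have k8 : (n - 2 * R) * C ^ 2 + (-2 + 8 * (n * m)) * C - (2 * R + n) = 0 := by
          simpa [h0] using k7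
        have k9 : ((n - 2 * R) * C + (-1 + 4 * (n * m))) ^ 2 = -8 * (3 + n * m) := by
          linear_combination (n - 2 * R) * k8 + (1 + 16 * m ^ 2) * hn2 - 16 * hm - 4 * hR
        apply n3i (n * m) (i * ((n - 2 * R) * C + (-1 + 4 * (n * m))) / (2 * r)) (by linear_combination m ^ 2 * hn2 - hm)
        have hr0 := hR0 r hr
        field_simp
        linear_combination i ^ 2 * k9 - 8 * (3 + n * m) * hi - 4 * (3 + n * m) * hr


section step
open WeierstrassCurve WeierstrassCurve.Affine

lemma fq_step1 {L : Type*} [Field L] [CharZero L] (σ : L →+* L) (hσ : ∀ z, σ (σ z) = z)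
    (r : L) (hr : r ^ 2 = 2) (hσr : σ r = -r) (hfix : ∀ x, σ x = x → ∃ q : ℚ, x = q)
    (x y : L) (hxy : y ^ 2 = x ^ 3 - x) : FqTor x y := by
  classical
  have h := (fq_nonsing x y).mpr hxy
  rw [← fq_four h]
  refine fq_galois σ hσ 2 ?_ _
  intro x y h hx hy
  apply fq_two_zero
  rw [fq_nonsing] at h
  obtain ⟨q, rfl⟩ := hfix x hx
  rcases hy with hy | hy
  · obtain ⟨p, rfl⟩ := hfix y hy
    have := fq_E1_rat q p (by exact_mod_cast h)
    rw [this]; simp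
  · obtain ⟨p, hp⟩ := hfix (y * r) (by rw [map_mul, hy, hσr]; ring)
    have e : (2 * p) ^ 2 = (2 * q) ^ 3 - 4 * (2 * q) := by
      have : (2 * (p : L)) ^ 2 = (2 * q) ^ 3 - 4 * (2 * q) := by
        rw [← hp]; linear_combination 4 * r ^ 2 * h + 4 * ((q : L) ^ 3 - q) * hr
      exact_mod_cast this
    have := fq_E2_rat _ _ e
    have hp0 : p = 0 := by linarith
    rw [hp0] at hp
    have hr0 : r ≠ 0 := by rintro rfl; norm_num at hr
    simpa [hr0] using hp

lemma fq_step2 {M L : Type*} [Field L] [CharZero L] [Field M] [CharZero M] (ι : M →+* L)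
    (hM : ∀ x y : M, y ^ 2 = x ^ 3 - x → FqTor x y) (σ : L →+* L) (hσ : ∀ z, σ (σ z) = z)
    (i : L) (hi : i ^ 2 = -1) (hσi : σ i = -i) (hfix : ∀ x, σ x = x → ∃ q : M, x = ι q)
    (n1 : ∀ x u : L, x ^ 2 = -1 → u ^ 2 ≠ x - 1)
    (n2 : ∀ x u : L, x ^ 2 - 2 * x - 1 = 0 → u ^ 2 ≠ x)
    (n3 : ∀ x u : L, x ^ 2 + 2 * x - 1 = 0 → u ^ 2 ≠ x)
    (x y : L) (hxy : y ^ 2 = x ^ 3 - x) : FqTor x y := by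
  classical
  have h := (fq_nonsing x y).mpr hxy
  refine fq_eight n1 n2 n3 h ?_
  refine fq_galois σ hσ 4 ?_ _
  intro x y h hx hy
  rw [fq_four]
  rw [fq_nonsing] at h
  obtain ⟨q, rfl⟩ := hfix x hx
  have h2 : ι 2 = 2 := map_ofNat ι 2
  rcases hy with hy | hy
  · obtain ⟨p, rfl⟩ := hfix y hy
    have := hM q p (ι.injective (by simpa using h))
    rcases this with h | h | h | h
    · exact Or.inl (by rw [h, map_zero])
    · exact Or.inr (Or.inl (by simpa [h2] using congrArg ι h))
    · exact Or.inr (Or.inr (Or.inl (by simpa [h2] using congrArg ι h)))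
    · exact Or.inr (Or.inr (Or.inr (by simpa [h2] using congrArg ι h)))
  · obtain ⟨p, hp⟩ := hfix (y * i) (by rw [map_mul, hy, hσi]; ring)
    have := hM (-q) p (ι.injective (by
      simp only [map_pow, map_sub, map_neg]
      rw [← hp]
      linear_combination i ^ 2 * h + (ι q ^ 3 - ι q) * hi))
    rcases this with h | h | h | h
    · left
      rw [h, map_zero] at hp
      have hi0 : i ≠ 0 := by rintro rfl; norm_num at hi
      simpa [hi0] using hp
    · exact Or.inr (Or.inl (by simpa [h2] using congrArg ι h))
    · exact Or.inr (Or.inr (Or.inr (by simpa [h2] using congrArg ι h)))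
    · exact Or.inr (Or.inr (Or.inl (by 
        have := congrArg ι h
        simp only [map_pow, map_sub, map_neg, map_add, map_mul, map_one, map_zero, map_ofNat] at this
        linear_combination this)))
end step

section fqfields
open scoped QuadraticAlgebra

abbrev FqF := QuadraticAlgebra ℚ 2 0


lemma fq_rat_sq {c : ℚ} (h : ¬ IsSquare c) (u : ℚ) : u ^ 2 ≠ c := by
  rintro rfl
  exact h ⟨u, by ring⟩

instance fqFactF : Fact (∀ r : ℚ, r ^ 2 ≠ 2 + 0 * r) := ⟨by
  intro r h
  rw [zero_mul, add_zero] at h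
  exact fq_rat_sq (by norm_num) r h⟩

abbrev FqK := QuadraticAlgebra FqF (-1) 0

lemma fqF_ext {z w : FqF} : z = w ↔ z.re = w.re ∧ z.im = w.im := QuadraticAlgebra.ext_iff
lemma fqK_ext {z w : FqK} : z = w ↔ z.re = w.re ∧ z.im = w.im := QuadraticAlgebra.ext_iff

lemma fqF_sq {u c : FqF} (h : u ^ 2 = c) : c.re = u.re ^ 2 + 2 * u.im ^ 2 ∧ c.im = 2 * u.re * u.im := by
  rw [← h]
  constructor
  · simp [pow_two]; ring
  · simp [pow_two]; ring

lemma fqF_norm {u c : FqF} (h : u ^ 2 = c) : (u.re ^ 2 - 2 * u.im ^ 2) ^ 2 = c.re ^ 2 - 2 * c.im ^ 2 := by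
  obtain ⟨h1, h2⟩ := fqF_sq h
  rw [h1, h2]; ring

lemma fqK_sq {u c : FqK} (h : u ^ 2 = c) : c.re = u.re ^ 2 - u.im ^ 2 ∧ c.im = 2 * u.re * u.im := by
  rw [← h]
  constructor
  · simp [pow_two]; ring
  · simp [pow_two]; ring

instance fqFactK : Fact (∀ r : FqF, r ^ 2 ≠ -1 + 0 * r) := ⟨by
  intro r h
  rw [zero_mul, add_zero] at h
  have := (fqF_sq h).1
  simp at this
  nlinarith [sq_nonneg r.re, sq_nonneg r.im]⟩

/-- the square root of two in the base -/
def fqr : FqF := ⟨0, 1⟩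
def fqR : FqK := ⟨fqr, 0⟩
def fqI : FqK := ⟨0, 1⟩

lemma fqF_two : (2 : FqF) = ⟨2, 0⟩ := rfl
lemma fqK_two : (2 : FqK) = ⟨2, 0⟩ := rfl

lemma fqr_sq : fqr ^ 2 = 2 := by
  rw [fqF_two]; ext <;> simp [fqr, pow_two]
lemma fqR_sq : fqR ^ 2 = 2 := by
  rw [fqK_two, ← fqr_sq]; ext <;> simp [fqR, pow_two]
lemma fqI_sq : fqI ^ 2 = -1 := by
  ext <;> simp [fqI, pow_two]

lemma fqF_tor (x y : FqF) (h : y ^ 2 = x ^ 3 - x) : FqTor x y := by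
  refine fq_step1 (starRingEnd _) (by simp) fqr fqr_sq ?_ ?_ x y h
  · ext <;> simp [starRingEnd_apply, fqr]
  · intro x hx
    refine ⟨x.re, ?_⟩
    simp [QuadraticAlgebra.ext_iff, starRingEnd_apply] at hx
    ext
    · simp
    · simp; linarith

lemma fqK_nonsq {c : FqF} (h : ¬ IsSquare (c.re ^ 2 - 2 * c.im ^ 2)) (u : FqK) : u ^ 2 ≠ ⟨c, 0⟩ := by
  intro hu
  obtain ⟨h1, h2⟩ := fqK_sq hu
  simp only at h1 h2
  have h3 : u.re = 0 ∨ u.im = 0 := by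
    simpa using h2.symm
  rcases h3 with h3 | h3
  · have : u.im ^ 2 = - c := by rw [h1, h3]; ring
    apply fq_rat_sq h _ ((fqF_norm this).trans _)
    simp
  · have : u.re ^ 2 = c := by rw [h1, h3]; ring
    exact fq_rat_sq h _ (fqF_norm this)

lemma fqK_R {R : FqK} (h : R ^ 2 = 2) : R = fqR ∨ R = - fqR := by
  rw [← fqR_sq] at h
  exact sq_eq_sq_iff_eq_or_eq_neg.mp h
lemma fqK_I {R : FqK} (h : R ^ 2 = -1) : R = fqI ∨ R = - fqI := by
  rw [← fqI_sq] at h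
  exact sq_eq_sq_iff_eq_or_eq_neg.mp h

lemma fqK_mk (a b : ℚ) : (a : FqK) + b * fqR = ⟨⟨a, b⟩, 0⟩ := by
  ext <;> simp [fqR, fqr]

lemma fqK_nonsq' {a b : ℚ} (h : ¬ IsSquare (a ^ 2 - 2 * b ^ 2)) (u : FqK) : u ^ 2 ≠ a + b * fqR := by
  rw [fqK_mk]
  exact fqK_nonsq h u

lemma fqK_nr (u : FqK) : u ^ 2 ≠ fqR := by
  have := fqK_nonsq' (a := 0) (b := 1) (by norm_num) u
  simpa using this
lemma fqK_n7 (u : FqK) : u ^ 2 ≠ 7 * fqR := by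
  have := fqK_nonsq' (a := 0) (b := 7) (by norm_num) u
  simpa using this
lemma fqK_n3r (u : FqK) : u ^ 2 ≠ 3 * fqR := by
  have := fqK_nonsq' (a := 0) (b := 3) (by norm_num) u
  simpa using this
lemma fqK_nh (R u : FqK) (h : R ^ 2 = 2) : u ^ 2 ≠ 1 + R := by
  rcases fqK_R h with rfl | rfl
  · have := fqK_nonsq' (a := 1) (b := 1) (by norm_num) u
    simpa using this
  · have := fqK_nonsq' (a := 1) (b := -1) (by norm_num) u
    simpa using this
lemma fqK_n13 (R u : FqK) (h : R ^ 2 = 2) : u ^ 2 ≠ 13 + 9 * R := by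
  rcases fqK_R h with rfl | rfl
  · have := fqK_nonsq' (a := 13) (b := 9) (by norm_num) u
    simpa using this
  · have := fqK_nonsq' (a := 13) (b := -9) (by norm_num) u
    simpa using this
lemma fqK_t1 (x u : FqK) (h : x ^ 2 - 2 * x - 1 = 0) : u ^ 2 ≠ x := by
  have : x = 1 + (x - 1) := by ring
  rw [this]
  exact fqK_nh _ _ (by linear_combination h)
lemma fqK_t2 (x u : FqK) (h : x ^ 2 + 2 * x - 1 = 0) : u ^ 2 ≠ x := by
  intro hu
  apply fqK_nh (- x - 1 ) (fqI * u) (by linear_combination h)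
  rw [mul_pow, hu, fqI_sq]; ring
lemma fqF_nat {q : ℚ} (h : ¬ IsSquare q) (h' : ¬ IsSquare (q / 2)) (u : FqF) : u ^ 2 ≠ ⟨q, 0⟩ := by
  intro hu
  obtain ⟨h1, h2⟩ := fqF_sq hu
  simp at h1 h2
  rcases h2 with h2 | h2
  · apply h'
    exact ⟨u.im, by rw [h1, h2]; ring⟩
  · apply h
    exact ⟨u.re, by rw [h1, h2]; ring⟩
lemma fqK_n3 (u : FqK) : u ^ 2 ≠ 3 := by
  intro hu
  obtain ⟨h1, h2⟩ := fqK_sq hu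
  have h3 : u.re = 0 ∨ u.im = 0 := by
    have : (3 : FqK).im = 0 := rfl
    rw [this] at h2
    simpa using h2.symm
  have e : (3 : FqK).re = ⟨3, 0⟩ := rfl
  rw [e] at h1
  rcases h3 with h3 | h3
  · refine fqF_nat (q := -3) (by norm_num) (by norm_num) u.im ?_
    rw [h3] at h1
    have : u.im ^ 2 = - (⟨3, 0⟩ : FqF) := by rw [h1]; ring
    rw [this]; ext <;> simp
  · refine fqF_nat (q := 3) (by norm_num) (by norm_num) u.re ?_
    rw [h3] at h1
    rw [h1]; ring
lemma fqK_n3i (R u : FqK) (h : R ^ 2 = -1) : u ^ 2 ≠ 3 + R := by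
  intro hu
  obtain ⟨h1, h2⟩ := fqK_sq hu
  refine fqF_nat (q := 10) (by norm_num) (by norm_num) (u.re ^ 2 + u.im ^ 2) ?_
  have e : (3 : FqK).re = 3 := rfl
  have e' : (3 : FqK).im = 0 := rfl
  have e2 : (⟨10, 0⟩ : FqF) = 10 := rfl
  rw [e2]
  rcases fqK_I h with rfl | rfl
  · simp [e, e', fqI] at h1 h2
    linear_combination -(u.re ^ 2 - u.im ^ 2 + 3) * h1 - (2 * u.re * u.im + 1) * h2
  · simp [e, e', fqI] at h1 h2
    linear_combination -(u.re ^ 2 - u.im ^ 2 + 3) * h1 - (2 * u.re * u.im - 1) * h2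
lemma fqK_n1 (R u : FqK) (h : R ^ 2 = -1) : u ^ 2 ≠ R - 1 := by
  intro hu
  obtain ⟨h1, h2⟩ := fqK_sq hu
  have h3 : -1 = u.re ^ 2 - u.im ^ 2 ∧ (u.re ^ 2 + u.im ^ 2) ^ 2 = fqr ^ 2 := by
    rw [fqr_sq]
    rcases fqK_I h with rfl | rfl
    · simp [fqI] at h1 h2
      refine ⟨h1, ?_⟩
      linear_combination -(u.re ^ 2 - u.im ^ 2 - 1) * h1 - (2 * u.re * u.im + 1) * h2
    · simp [fqI] at h1 h2
      refine ⟨h1, ?_⟩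
      linear_combination -(u.re ^ 2 - u.im ^ 2 - 1) * h1 - (2 * u.re * u.im - 1) * h2
  obtain ⟨h3, h4⟩ := h3
  have h20 : (2 : FqF) ≠ 0 := two_ne_zero
  rcases sq_eq_sq_iff_eq_or_eq_neg.mp h4 with h5 | h5
  · have := fqF_norm (u := fqr * u.re) (c := ⟨-1, 1⟩) (by
      have : (⟨-1, 1⟩ : FqF) = - 1 + fqr := by ext <;> simp [fqr]
      rw [this]
      linear_combination h5 - h3 + u.re ^ 2 * fqr_sq)
    norm_num at this
    nlinarith [sq_nonneg ((fqr * u.re).re ^ 2 - 2 * (fqr * u.re).im ^ 2)]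
  · have := fqF_norm (u := fqr * u.re) (c := ⟨-1, -1⟩) (by
      have : (⟨-1, -1⟩ : FqF) = - 1 - fqr := by ext <;> simp [fqr]
      rw [this]
      linear_combination h5 - h3 + u.re ^ 2 * fqr_sq)
    norm_num at this
    nlinarith [sq_nonneg ((fqr * u.re).re ^ 2 - 2 * (fqr * u.re).im ^ 2)]

lemma fqK_tor (x y : FqK) (h : y ^ 2 = x ^ 3 - x) : FqTor x y := by
  refine fq_step2 (algebraMap FqF FqK) fqF_tor (starRingEnd _) (by simp) fqI fqI_sq ?_ ?_
    fqK_n1 fqK_t1 fqK_t2 x y h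
  · ext <;> simp [starRingEnd_apply, fqI]
  · intro x hx
    refine ⟨x.re, ?_⟩
    simp [QuadraticAlgebra.ext_iff, starRingEnd_apply] at hx
    have h0 : x.im = 0 := by
      ext <;> simp <;> linarith
    rw [QuadraticAlgebra.algebraMap_eq]
    ext <;> simp [h0]

end fqfields


section fqD
variable {k : Type*} [Field k] [CharZero k]

lemma fq_listE2 (i : k) (hi : i ^ 2 = -1) (htor : ∀ x y : k, y ^ 2 = x ^ 3 - x → FqTor x y)
    {z w : k} (h : w ^ 2 = 2 * z * (1 + z ^ 2)) :
    z = 0 ∨ z ^ 2 = -1 ∨ z ^ 2 = 1 ∨ ∃ j R, j ^ 2 = -1 ∧ R ^ 2 = 2 ∧ z = j * (1 + R) := by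
  have h1 : (1 - i) * (1 + i) = 2 := by linear_combination -hi
  have := htor (-i * z) (w * (1 + i) / 2) (by
    linear_combination ((1 + i) ^ 2 / 4) * h + (z * (1 + z ^ 2) / 2) * hi + i * z ^ 3 * hi)
  rcases this with hy | hx | hx | hx
  · have hw : w = 0 := by
      have : w * ((1 - i) * (1 + i)) = 0 := by linear_combination 2 * (1 - i) * hy
      rw [h1] at this
      simpa using this
    rw [hw] at h
    have : z * (1 + z ^ 2) = 0 := by linear_combination -h / 2
    rcases mul_eq_zero.mp this with h | h
    · exact Or.inl h
    · exact Or.inr (Or.inl (by linear_combination h))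
  · exact Or.inr (Or.inr (Or.inl (by linear_combination -hx + z ^ 2 * hi)))
  · exact Or.inr (Or.inr (Or.inr ⟨i, -i * z - 1, hi, by linear_combination hx, by linear_combination z * hi⟩))
  · exact Or.inr (Or.inr (Or.inr ⟨-i, i * z - 1, by linear_combination hi, by linear_combination hx, by linear_combination z * hi⟩))

lemma fq_listE3 (i r : k) (hi : i ^ 2 = -1) (hr : r ^ 2 = 2) (htor : ∀ x y : k, y ^ 2 = x ^ 3 - x → FqTor x y)
    {v w : k} (h : w ^ 2 = 2 * v * (1 - v ^ 2)) :
    v = 0 ∨ v ^ 2 = 1 ∨ v ^ 2 = -1 ∨ ∃ e R, e ^ 2 = 1 ∧ R ^ 2 = 2 ∧ v = e * (1 + R) := by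
  have := htor v (w * (i * r) / 2) (by
    linear_combination ((i * r) ^ 2 / 4) * h + (v * (1 - v ^ 2) / 2) * r ^ 2 * hi - (v * (1 - v ^ 2) / 2) * hr)
  rcases this with hy | hx | hx | hx
  · have hw : w = 0 := by
      have : w * 2 = 0 := by linear_combination -2 * i * r * hy + w * r ^ 2 * hi - w * hr
      simpa using this
    rw [hw] at h
    have : v * (1 - v ^ 2) = 0 := by linear_combination -h / 2
    rcases mul_eq_zero.mp this with h | h
    · exact Or.inl h
    · exact Or.inr (Or.inl (by linear_combination -h))
  · exact Or.inr (Or.inr (Or.inl hx))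
  · exact Or.inr (Or.inr (Or.inr ⟨1, v - 1, by ring, by linear_combination hx, by ring⟩))
  · exact Or.inr (Or.inr (Or.inr ⟨-1, -v - 1, by ring, by linear_combination hx, by ring⟩))

lemma fq_L2 (i : k) (hi : i ^ 2 = -1) (htor : ∀ x y : k, y ^ 2 = x ^ 3 - x → FqTor x y)
    {t b : k} (ht : 1 + t ^ 2 ≠ 0) (h : (1 + t ^ 2) * b ^ 2 = 2 * t) : b ^ 4 = 0 ∨ b ^ 4 = 1 ∨ b ^ 4 = -1 := by
  rcases fq_listE2 i hi htor (z := t) (w := (1 + t ^ 2) * b) (by linear_combination (1 + t ^ 2) * h) with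
    h0 | h0 | h0 | ⟨j, R, hj, hR, h0⟩
  · left
    subst h0
    have : b ^ 2 = 0 := by linear_combination h
    linear_combination b ^ 2 * this
  · exact absurd (by rw [h0]; ring) ht
  · right; left
    have : b ^ 2 = t := by linear_combination h / 2 - b ^ 2 / 2 * h0
    linear_combination (b ^ 2 + t) * this + h0
  · right; right
    have h1 : 1 + t ^ 2 = -2 * (1 + R) := by rw [h0]; linear_combination (1 + R) ^ 2 * hj - hR
    rw [h1] at h ht
    have hR1 : 1 + R ≠ 0 := by intro h; apply ht; rw [h]; ring
    have : (-2 * (1 + R)) * (b ^ 2 + j) = 0 := by rw [h0] at h; linear_combination h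
    have : b ^ 2 = - j := by
      rcases mul_eq_zero.mp this with h | h
      · exact absurd h ht
      · linear_combination h
    linear_combination (b ^ 2 - j) * this + hj

lemma fq_L1 (i : k) (hi : i ^ 2 = -1) (htor : ∀ x y : k, y ^ 2 = x ^ 3 - x → FqTor x y)
    {t a : k} (ht : 1 + t ^ 2 ≠ 0) (h : (1 + t ^ 2) * a ^ 2 = 1 - t ^ 2) : a ^ 4 = 0 ∨ a ^ 4 = 1 ∨ a ^ 4 = -1 := by
  by_cases h1 : 1 + t = 0
  · left
    have : t = -1 := by linear_combination h1
    subst this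
    have : a ^ 2 = 0 := by linear_combination h / 2
    linear_combination a ^ 2 * this
  · have e : 1 + ((1 - t) / (1 + t)) ^ 2 = 2 * (1 + t ^ 2) / (1 + t) ^ 2 := by field_simp; ring
    refine fq_L2 i hi htor (t := (1 - t) / (1 + t)) ?_ ?_
    · rw [e]
      exact div_ne_zero (mul_ne_zero two_ne_zero ht) (pow_ne_zero _ h1)
    · rw [e]
      field_simp
      linear_combination h

lemma fq_L3 (i r : k) (hi : i ^ 2 = -1) (hr : r ^ 2 = 2) (htor : ∀ x y : k, y ^ 2 = x ^ 3 - x → FqTor x y)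
    {t c : k} (ht : 1 + t ^ 2 ≠ 0) (h : (1 + t ^ 2) ^ 2 * c ^ 2 = 2 * t * (1 - t ^ 2)) :
    t = 0 ∨ t ^ 2 = 1 ∨ 2 * (2 * t) ^ 2 = (1 + t ^ 2) ^ 2 := by
  rcases fq_listE3 i r hi hr htor (v := t) (w := (1 + t ^ 2) * c) (by linear_combination h) with
    h0 | h0 | h0 | ⟨j, R, hj, hR, h0⟩
  · exact Or.inl h0
  · exact Or.inr (Or.inl h0)
  · exact absurd (by rw [h0]; ring) ht
  · right; right
    have : t ^ 2 = 3 + 2 * R := by rw [h0]; linear_combination (1 + R) ^ 2 * hj + hR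
    linear_combination (8 - (1 + t ^ 2) - (4 + 2 * R)) * this - 4 * hR

lemma fq_h2 (i : k) (hi : i ^ 2 = -1) (htor : ∀ x y : k, y ^ 2 = x ^ 3 - x → FqTor x y)
    {B C p q : k} (e1 : p ^ 2 - q ^ 2 * C - 2 * B * C = 0)
    (e2 : 2 * p * q - q ^ 2 * B - 2 - 2 * (B ^ 2 - C) = 0) :
    C = 1 ∨ (∃ j, j ^ 2 = -1 ∧ C = -1 - j * B) ∨ (∃ e, e ^ 2 = 1 ∧ (e * B + C + 1) ^ 2 = 8 * C) ∨
      (∃ j R, j ^ 2 = -1 ∧ R ^ 2 = 2 ∧ ((1 + R) * j * B + C + 1) ^ 2 = -8 * (1 + R) * C) := by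
  obtain ⟨z, hz⟩ : ∃ z, z = B + q ^ 2 / 2 := ⟨_, rfl⟩
  obtain ⟨w, hw⟩ : ∃ w, w = p + q * z := ⟨_, rfl⟩
  have h : w ^ 2 = 2 * z * (1 + z ^ 2) := by
    rw [hw, hz]; linear_combination e1 + (B + q ^ 2 / 2) * e2
  have hq : q ^ 2 = 2 * (z - B) := by rw [hz]; ring
  have hC : C = 2 * z ^ 2 + 1 - z * B - w * q := by
    rw [hw, hz]; linear_combination e2 / 2
  rcases fq_listE2 i hi htor h with h0 | h0 | h0 | ⟨j, R, hj, hR, h0⟩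
  · left
    have hw0 : w = 0 := by rw [h0] at h; simpa using h
    rw [hC, h0, hw0]; ring
  · right; left
    refine ⟨z, h0, ?_⟩
    have hw0 : w = 0 := by rw [h0] at h; simpa using h
    rw [hC, hw0]; linear_combination 2 * h0
  · right; right; left
    refine ⟨z, h0, ?_⟩
    have hw2 : w ^ 2 = 4 * z := by rw [h, h0]; ring
    have : z * B + C + 1 = 4 - w * q := by rw [hC]; linear_combination 2 * h0
    rw [this]
    have hC' : C = 3 - z * B - w * q := by rw [hC]; linear_combination 2 * h0
    rw [hC']
    linear_combination q ^ 2 * hw2 + 4 * z * hq + 8 * h0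
  · right; right; right
    refine ⟨j, R, hj, hR, ?_⟩
    obtain ⟨H, hH⟩ : ∃ H, H = 1 + R := ⟨_, rfl⟩
    rw [← hH] at h0 ⊢
    have hH2 : H ^ 2 = 1 + 2 * H := by rw [hH]; linear_combination hR
    have hz2 : z ^ 2 = -H ^ 2 := by rw [h0]; linear_combination H ^ 2 * hj
    have hw2 : w ^ 2 = -4 * j * H ^ 2 := by rw [h, hz2, h0]; linear_combination -2 * j * H * hH2
    have hC' : C = -2 * H ^ 2 + 1 - H * j * B - w * q := by rw [hC, hz2, h0]; ring
    have : H * j * B + C + 1 = -4 * H - w * q := by rw [hC']; linear_combination -2 * hH2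
    rw [this, hC']
    rw [h0] at hq
    linear_combination q ^ 2 * hw2 - 4 * j * H ^ 2 * hq - 8 * H ^ 3 * hj - 8 * H * hH2

lemma fq_h3 (i r : k) (hi : i ^ 2 = -1) (hr : r ^ 2 = 2) (htor : ∀ x y : k, y ^ 2 = x ^ 3 - x → FqTor x y)
    {B C p q : k} (e1 : p ^ 2 - q ^ 2 * C + 2 * B * C = 0)
    (e2 : 2 * p * q - q ^ 2 * B - 2 + 2 * (B ^ 2 - C) = 0) :
    C = -1 ∨ (∃ e, e ^ 2 = 1 ∧ C = 1 - e * B) ∨ (∃ j, j ^ 2 = -1 ∧ (1 - C - j * B) ^ 2 = -8 * C) ∨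
      (∃ e R, e ^ 2 = 1 ∧ R ^ 2 = 2 ∧ ((1 + R) * e * B + C - 1) ^ 2 = 8 * (1 + R) * C) := by
  obtain ⟨z, hz⟩ : ∃ z, z = B - q ^ 2 / 2 := ⟨_, rfl⟩
  obtain ⟨w, hw⟩ : ∃ w, w = p + q * z := ⟨_, rfl⟩
  have h : w ^ 2 = 2 * z * (1 - z ^ 2) := by
    rw [hw, hz]; linear_combination e1 + (B - q ^ 2 / 2) * e2
  have hq : q ^ 2 = 2 * (B - z) := by rw [hz]; ring
  have hC : C = w * q - z * B + 2 * z ^ 2 - 1 := by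
    rw [hw, hz]; linear_combination -e2 / 2
  rcases fq_listE3 i r hi hr htor h with h0 | h0 | h0 | ⟨j, R, hj, hR, h0⟩
  · left
    have hw0 : w = 0 := by rw [h0] at h; simpa using h
    rw [hC, h0, hw0]; ring
  · right; left
    refine ⟨z, h0, ?_⟩
    have hw0 : w = 0 := by rw [h0] at h; simpa using h
    rw [hC, hw0]; linear_combination 2 * h0
  · right; right; left
    refine ⟨z, h0, ?_⟩
    have hw2 : w ^ 2 = 4 * z := by rw [h, h0]; ring
    have hC' : C = w * q - z * B - 3 := by rw [hC]; linear_combination 2 * h0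
    rw [hC']
    linear_combination q ^ 2 * hw2 + 4 * z * hq - 8 * h0
  · right; right; right
    refine ⟨j, R, hj, hR, ?_⟩
    obtain ⟨H, hH⟩ : ∃ H, H = 1 + R := ⟨_, rfl⟩
    rw [← hH] at h0 ⊢
    have hH2 : H ^ 2 = 1 + 2 * H := by rw [hH]; linear_combination hR
    have hz2 : z ^ 2 = H ^ 2 := by rw [h0]; linear_combination H ^ 2 * hj
    have hw2 : w ^ 2 = -4 * j * H ^ 2 := by rw [h, hz2, h0]; linear_combination -2 * j * H * hH2
    have hC' : C = w * q - H * j * B + 2 * H ^ 2 - 1 := by rw [hC, hz2, h0]; ring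
    have : H * j * B + C - 1 = w * q + 4 * H := by rw [hC']; linear_combination 2 * hH2
    rw [this, hC']
    rw [h0] at hq
    linear_combination q ^ 2 * hw2 - 4 * j * H ^ 2 * hq + 8 * H ^ 3 * hj - 8 * H * hH2

variable {K : Type*} [Field K] [CharZero K]

lemma fq_red (ι : k →+* K) (r : k) (s : K) (hs : s ^ 2 = ι r)
    (hK : ∀ z : K, ∃ a b : k, z = ι a + ι b * s) (hinj : ∀ a b : k, ι a + ι b * s = 0 → a = 0 ∧ b = 0)
    (t0 t1 : k) (ht1 : t1 ≠ 0) (ε : k) (u t : K) (ht : t = ι t0 + ι t1 * s) (hu : u ^ 2 = 2 * t * (1 + ι ε * t ^ 2)) :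
    ∃ p q : k, p ^ 2 - q ^ 2 * (t0 ^ 2 - r * t1 ^ 2) - 2 * ε * (-2 * t0) * (t0 ^ 2 - r * t1 ^ 2) = 0 ∧
     2 * p * q - q ^ 2 * (-2 * t0) - 2 - 2 * ε * ((-2 * t0) ^ 2 - (t0 ^ 2 - r * t1 ^ 2)) = 0 := by
  obtain ⟨p', q', hpq⟩ := hK u
  obtain ⟨q, hq⟩ : ∃ q, q = q' / t1 := ⟨_, rfl⟩
  have hq' : q' = q * t1 := by rw [hq]; field_simp
  refine ⟨p' - q * t0, q, ?_⟩
  obtain ⟨E1, hE1⟩ : ∃ E, E = (p' - q * t0) ^ 2 - q ^ 2 * (t0 ^ 2 - r * t1 ^ 2) - 2 * ε * (-2 * t0) * (t0 ^ 2 - r * t1 ^ 2) := ⟨_, rfl⟩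
  obtain ⟨E2, hE2⟩ : ∃ E, E = 2 * (p' - q * t0) * q - q ^ 2 * (-2 * t0) - 2 - 2 * ε * ((-2 * t0) ^ 2 - (t0 ^ 2 - r * t1 ^ 2)) := ⟨_, rfl⟩
  rw [← hE1, ← hE2]
  have key : ι (E1 + E2 * t0) + ι (E2 * t1) * s = 0 := by
    rw [hE1, hE2]
    rw [hpq, ht, hq'] at hu
    have h2 : ι 2 = 2 := map_ofNat ι 2
    simp only [map_add, map_mul, map_sub, map_pow, map_neg, h2] at hu ⊢
    linear_combination hu + (- ι q ^ 2 * ι t1 ^ 2 + 6 * ι ε * ι t0 * ι t1 ^ 2 + 2 * ι ε * ι t1 ^ 3 * s) * hs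
  obtain ⟨k1, k2⟩ := hinj _ _ key
  have h2 : E2 = 0 := by simpa [ht1] using k2
  refine ⟨?_, h2⟩
  rw [h2] at k1; simpa using k1

end fqD


section fqE
variable {K : Type*} [Field K] [CharZero K]

lemma fq_main (ι : FqK →+* K) (s : K) (hs : s ^ 2 = ι fqR)
    (hK : ∀ z : K, ∃ a b : FqK, z = ι a + ι b * s) (x y : K) (h : x ^ 4 + y ^ 4 = 1) :
    x ^ 4 = 0 ∨ x ^ 4 = 1 ∨ x ^ 4 = -1 ∨ y ^ 4 = 0 ∨ y ^ 4 = 1 ∨ y ^ 4 = -1 ∨ y ^ 4 = 1 / 2 := by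
  have hinj : ∀ a b : FqK, ι a + ι b * s = 0 → a = 0 ∧ b = 0 := by
    intro a b hab
    have hb : b = 0 := by
      by_contra hb
      have hb' : ι b ≠ 0 := by simpa using hb
      apply fqK_nr (-a / b)
      apply ι.injective
      rw [← hs, map_pow, map_div₀, map_neg]
      have : s = - ι a / ι b := by field_simp; linear_combination hab
      rw [this]
    subst hb
    simpa using hab
  have hhalf : ∀ (z : K) (c : FqK), z ^ 2 = ι c → (∃ a, z = ι a) ∨ ∃ b, z = ι b * s := by
    intro z c hc
    obtain ⟨a, b, rfl⟩ := hK z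
    have := hinj (a ^ 2 + b ^ 2 * fqR - c) (2 * a * b) (by
      have h2 : ι 2 = 2 := map_ofNat ι 2
      simp only [map_add, map_mul, map_sub, map_pow, h2]
      linear_combination hc - ι b ^ 2 * hs)
    have h3 : a = 0 ∨ b = 0 := by simpa using this.2
    rcases h3 with rfl | rfl
    · right; exact ⟨b, by simp⟩
    · left; exact ⟨a, by simp⟩
  by_cases hx1 : 1 + x ^ 2 = 0
  · right; left
    linear_combination (x ^ 2 - 1) * hx1
  obtain ⟨t, htd⟩ : ∃ t, t = y ^ 2 / (1 + x ^ 2) := ⟨_, rfl⟩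
  have hty : y ^ 2 = t * (1 + x ^ 2) := by rw [htd]; field_simp
  have ht2 : (1 + x ^ 2) * (1 + t ^ 2) = 2 := by
    have : (1 + x ^ 2) * ((1 + x ^ 2) * (1 + t ^ 2) - 2) = 0 := by
      linear_combination h - (y ^ 2 + t * (1 + x ^ 2)) * hty
    rcases mul_eq_zero.mp this with h | h
    · exact absurd h hx1
    · linear_combination h
  have ht0 : 1 + t ^ 2 ≠ 0 := by
    intro h0; rw [h0] at ht2; norm_num at ht2
  have hX : (1 + t ^ 2) * x ^ 2 = 1 - t ^ 2 := by linear_combination ht2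
  have hY : (1 + t ^ 2) * y ^ 2 = 2 * t := by linear_combination (1 + t ^ 2) * hty + t * ht2
  have h2 : ι 2 = 2 := map_ofNat ι 2
  obtain ⟨t0, t1, htt⟩ := hK t
  by_cases ht1 : t1 = 0
  · subst ht1
    rw [map_zero, zero_mul, add_zero] at htt
    subst htt
    have ht0' : 1 + t0 ^ 2 ≠ 0 := by
      intro h0; apply ht0
      have := congrArg ι h0
      simpa using this
    have conv : ∀ a : FqK, (a ^ 4 = 0 ∨ a ^ 4 = 1 ∨ a ^ 4 = -1) → (ι a ^ 4 = 0 ∨ ι a ^ 4 = 1 ∨ ι a ^ 4 = -1) := by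
      intro a ha
      rw [← map_pow]
      rcases ha with ha | ha | ha <;> rw [ha] <;> simp
    have hx2 : x ^ 2 = ι ((1 - t0 ^ 2) / (1 + t0 ^ 2)) := by
      simp only [map_div₀, map_add, map_sub, map_pow, map_one]
      field_simp
      linear_combination hX
    have hy2 : y ^ 2 = ι (2 * t0 / (1 + t0 ^ 2)) := by
      simp only [map_div₀, map_add, map_sub, map_pow, map_one, map_mul, h2]
      field_simp
      linear_combination hY
    rcases hhalf _ _ hx2 with ⟨a, ha⟩ | ⟨a, ha⟩
    · have := fq_L1 fqI fqI_sq fqK_tor (t := t0) (a := a) ht0' (ι.injective (by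
        simp only [map_add, map_sub, map_pow, map_one, map_mul, h2]
        rw [← ha]; exact hX))
      have := conv a this
      rw [← ha] at this
      tauto
    rcases hhalf _ _ hy2 with ⟨b, hb⟩ | ⟨b, hb⟩
    · have := fq_L2 fqI fqI_sq fqK_tor (t := t0) (b := b) ht0' (ι.injective (by
        simp only [map_add, map_sub, map_pow, map_one, map_mul, h2]
        rw [← hb]; exact hY))
      have := conv b this
      rw [← hb] at this
      tauto
    have := fq_L3 fqI fqR fqI_sq fqR_sq fqK_tor (t := t0) (c := a * b * fqR) ht0' (ι.injective (by
        simp only [map_add, map_sub, map_pow, map_one, map_mul, h2]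
        have : ι a * ι b * ι fqR = x * y := by rw [ha, hb, ← hs]; ring
        rw [this]
        linear_combination (1 + ι t0 ^ 2) * y ^ 2 * hX + (1 - ι t0 ^ 2) * hY))
    rcases this with h0 | h0 | h0
    · subst h0
      right; right; right; left
      simp at hY
      simp [hY]
    · left
      have e : ι t0 ^ 2 = 1 := by rw [← map_pow, h0, map_one]
      rw [e] at hX
      have : x ^ 2 = 0 := by linear_combination hX / 2
      linear_combination x ^ 2 * this
    · right; right; right; right; right; right
      have e := congrArg ι h0
      simp only [map_add, map_sub, map_pow, map_one, map_mul, h2] at e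
      rw [eq_div_iff two_ne_zero]
      apply mul_left_cancel₀ (pow_ne_zero 2 ht0)
      linear_combination e + 2 * ((1 + ι t0 ^ 2) * y ^ 2 + 2 * ι t0) * hY
  · exfalso
    obtain ⟨p, q, e1, e2⟩ := fq_red ι fqR s hs hK hinj t0 t1 ht1 1 ((1 + t ^ 2) * y) t htt (by
      simp only [map_one]; linear_combination (1 + t ^ 2) * hY)
    obtain ⟨p', q', e1', e2'⟩ := fq_red ι fqR s hs hK hinj t0 t1 ht1 (-1) ((1 + t ^ 2) * (x * y)) t htt (by
      simp only [map_one, map_neg]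
      linear_combination (1 + t ^ 2) * y ^ 2 * hX + (1 - t ^ 2) * hY)
    exact fq_cases fqI fqR fqI_sq fqR_sq fqK_nr fqK_n7 fqK_n3 fqK_n3r fqK_nh fqK_n13 fqK_n3i
      (-2 * t0) (t0 ^ 2 - fqR * t1 ^ 2) (2 * t1) (mul_ne_zero two_ne_zero ht1) (by ring)
      (fq_h2 fqI fqI_sq fqK_tor (p := p) (q := q) (by linear_combination e1) (by linear_combination e2))
      (fq_h3 fqI fqR fqI_sq fqR_sq fqK_tor (p := p') (q := q') (by linear_combination e1') (by linear_combination e2'))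

lemma fq_map (R I : K) (hR : R ^ 2 = 2) (hI : I ^ 2 = -1) :
    ∃ ι : FqK →+* K, ι fqR = R ∧ ι fqI = I := by
  have e1 : (1 : FqK) = ⟨⟨1, 0⟩, 0⟩ := rfl
  have e0 : (0 : FqK) = ⟨⟨0, 0⟩, 0⟩ := rfl
  refine ⟨{ toFun := fun z => (z.re.re + z.re.im * R) + (z.im.re + z.im.im * R) * I
            map_one' := by rw [e1]; simp
            map_zero' := by simp
            map_add' := by intro a b; simp; ring
            map_mul' := ?_ }, ?_, ?_⟩
  · intro a b
    simp
    linear_combination (-(((a.im.re : K) + a.im.im * R) * (b.im.re + b.im.im * R))) * hI - ((a.re.im : K) * b.re.im - a.im.im * b.im.im + (a.re.im * b.im.im + a.im.im * b.re.im) * I) * hR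
  · simp [fqR, fqr]
  · have e1 : (1 : FqF) = ⟨1, 0⟩ := rfl
    simp [fqI, e1]

end fqE


section fqG
variable {K : Type*} [Field K] [CharZero K]

lemma fq_roots (z : K) (hz : z ^ 4 = -1) (x c : K) (hx : x ≠ 0) (hc : x ^ 4 = c) :
    {u : K | u ^ 4 = c}.ncard = 4 := by
  have hI : (z ^ 2) ^ 2 = -1 := by linear_combination hz
  obtain ⟨I, hI'⟩ : ∃ I, I = z ^ 2 := ⟨_, rfl⟩
  rw [← hI'] at hI
  have this : {u : K | u ^ 4 = c} = {x, -x, I * x, -(I * x)} := by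
    ext u
    simp only [Set.mem_setOf_eq, Set.mem_insert_iff, Set.mem_singleton_iff]
    constructor
    · intro h
      have h1 : (u - x) * ((u + x) * ((u - I * x) * (u + I * x))) = 0 := by
        linear_combination h - hc - x ^ 2 * (u ^ 2 - x ^ 2) * hI
      rcases mul_eq_zero.mp h1 with h | h
      · left; linear_combination h
      rcases mul_eq_zero.mp h with h | h
      · right; left; linear_combination h
      rcases mul_eq_zero.mp h with h | h
      · right; right; left; linear_combination h
      · right; right; right; linear_combination h
    · rintro (rfl | rfl | rfl | rfl)
      · exact hc
      · linear_combination hc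
      · linear_combination hc + x ^ 4 * (I ^ 2 - 1) * hI
      · linear_combination hc + x ^ 4 * (I ^ 2 - 1) * hI
  have k1 : ∀ w : K, w ≠ 0 → w ≠ -w := by
    intro w hw h
    apply hw
    linear_combination h / 2
  have k2 : ∀ a b : K, a ^ 2 ≠ b ^ 2 → a ≠ b := by
    rintro a b h rfl; exact h rfl
  have hI0 : I ≠ 0 := by rintro rfl; norm_num at hI
  have k3 : x ^ 2 ≠ - x ^ 2 := k1 _ (pow_ne_zero 2 hx)
  rw [this, Set.ncard_insert_of_notMem, Set.ncard_insert_of_notMem, Set.ncard_pair]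
  · exact k1 _ (mul_ne_zero hI0 hx)
  · simp only [Set.mem_insert_iff, Set.mem_singleton_iff, not_or]
    refine ⟨k2 _ _ ?_, k2 _ _ ?_⟩
    · rw [mul_pow, hI]; simpa using k3
    · rw [neg_sq, neg_sq, mul_pow, hI]; simpa using k3
  · simp only [Set.mem_insert_iff, Set.mem_singleton_iff, not_or]
    refine ⟨k1 _ hx, k2 _ _ ?_, k2 _ _ ?_⟩
    · rw [mul_pow, hI]; simpa using k3
    · rw [neg_sq, mul_pow, hI]; simpa using k3

lemma fq_count (g z : K) (hg : g ^ 4 = 2) (hz : z ^ 4 = -1)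
    (H : ∀ x y : K, x ^ 4 + y ^ 4 = 1 →
      x ^ 4 = 0 ∨ x ^ 4 = 1 ∨ x ^ 4 = -1 ∨ y ^ 4 = 0 ∨ y ^ 4 = 1 ∨ y ^ 4 = -1 ∨ y ^ 4 = 1 / 2) :
    {p : K × K | p.1 ^ 4 + p.2 ^ 4 = 1}.ncard = 56 := by
  obtain ⟨S, hS⟩ : ∃ S : K → Set K, S = fun c => {u : K | u ^ 4 = c} := ⟨_, rfl⟩
  have mem : ∀ c u, u ∈ S c ↔ u ^ 4 = c := by intro c u; rw [hS]; rfl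
  have hg0 : g ≠ 0 := by rintro rfl; norm_num at hg
  have hz0 : z ≠ 0 := by rintro rfl; norm_num at hz
  have c1 : (S 1).ncard = 4 := by rw [hS]; exact fq_roots z hz 1 1 one_ne_zero (by ring)
  have c2 : (S 2).ncard = 4 := by rw [hS]; exact fq_roots z hz g 2 hg0 hg
  have cm : (S (-1)).ncard = 4 := by rw [hS]; exact fq_roots z hz z (-1) hz0 hz
  have ch : (S (1/2)).ncard = 4 := by
    rw [hS]; exact fq_roots z hz g⁻¹ (1/2) (inv_ne_zero hg0) (by rw [inv_pow, hg]; norm_num)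
  have c0 : (S 0).ncard = 1 := by
    have : S 0 = {0} := by ext u; rw [mem]; simp
    rw [this, Set.ncard_singleton]
  have fin : ∀ c, (S c).ncard ≠ 0 → (S c).Finite := fun c h => Set.finite_of_ncard_ne_zero h
  have f1 := fin _ (by rw [c1]; norm_num)
  have f2 := fin _ (by rw [c2]; norm_num)
  have fm := fin _ (by rw [cm]; norm_num)
  have fh := fin _ (by rw [ch]; norm_num)
  have f0 := fin _ (by rw [c0]; norm_num)
  have e : {p : K × K | p.1 ^ 4 + p.2 ^ 4 = 1} =
      S 0 ×ˢ S 1 ∪ (S 1 ×ˢ S 0 ∪ (S 2 ×ˢ S (-1) ∪ (S (-1) ×ˢ S 2 ∪ S (1/2) ×ˢ S (1/2)))) := by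
    ext ⟨x, y⟩
    simp only [Set.mem_setOf_eq, Set.mem_union, Set.mem_prod, mem]
    constructor
    · intro h
      have hy : y ^ 4 = 1 - x ^ 4 := by linear_combination h
      have hx : x ^ 4 = 1 - y ^ 4 := by linear_combination h
      rcases H x y h with h0 | h0 | h0 | h0 | h0 | h0 | h0
      · left; rw [hy, h0]; norm_num
      · right; left; rw [hy, h0]; norm_num
      · right; right; right; left; rw [hy, h0]; norm_num
      · right; left; rw [hx, h0]; norm_num
      · left; rw [hx, h0]; norm_num
      · right; right; left; rw [hx, h0]; norm_num
      · right; right; right; right; rw [hx, h0]; norm_num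
    · rintro (⟨h, h'⟩ | ⟨h, h'⟩ | ⟨h, h'⟩ | ⟨h, h'⟩ | ⟨h, h'⟩) <;> rw [h, h'] <;> norm_num
  have n1 : (1 : K) ≠ -1 := by
    intro h
    have : (2 : K) = 0 := by linear_combination h
    exact two_ne_zero this
  have n2 : (2 : K) ≠ -1 := by
    intro h
    have : (3 : K) = 0 := by linear_combination h
    exact three_ne_zero this
  have n3 : (-1 : K) ≠ 1 / 2 := by
    intro h
    have : (3 : K) = 0 := by linear_combination -2 * h
    exact three_ne_zero this
  have dis : ∀ a b : K, a ≠ b → ∀ A B : Set K, Disjoint (S a ×ˢ A) (S b ×ˢ B) := by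
    intro a b hab A B
    rw [Set.disjoint_left]
    rintro ⟨x, y⟩ h1 h2
    exact hab (((mem _ _).mp h1.1).symm.trans ((mem _ _).mp h2.1))
  have F0 := f0.prod f1
  have F1 := f1.prod f0
  have F2 := f2.prod fm
  have F3 := fm.prod f2
  have F4 := fh.prod fh
  rw [e, Set.ncard_union_eq _ F0 (F1.union (F2.union (F3.union F4))),
    Set.ncard_union_eq _ F1 (F2.union (F3.union F4)), Set.ncard_union_eq _ F2 (F3.union F4),
    Set.ncard_union_eq _ F3 F4, Set.ncard_prod, Set.ncard_prod, Set.ncard_prod, Set.ncard_prod,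
    Set.ncard_prod, c0, c1, c2, cm, ch]
  · exact dis _ _ n3 _ _
  · exact Disjoint.union_right (dis _ _ n2 _ _) (dis _ _ (by norm_num) _ _)
  · exact Disjoint.union_right (dis _ _ (by norm_num) _ _)
      (Disjoint.union_right (dis _ _ n1 _ _) (dis _ _ (by norm_num) _ _))
  · exact Disjoint.union_right (dis _ _ (by norm_num) _ _) (Disjoint.union_right (dis _ _ (by norm_num) _ _)
      (Disjoint.union_right (dis _ _ (by norm_num) _ _) (dis _ _ (by norm_num) _ _)))

end fqG

lemma fq_final (γ ζ : ℂ) (hγ : γ ^ 4 = 2) (hζ : ζ ^ 4 = -1) (K : IntermediateField ℚ ℂ)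
    (hKd : K = IntermediateField.adjoin ℚ {γ, ζ}) :
    {p : K × K | p.1 ^ 4 + p.2 ^ 4 = 1}.ncard = 56 := by
  have hγK : γ ∈ K := by rw [hKd]; exact IntermediateField.subset_adjoin _ _ (by simp)
  have hζK : ζ ∈ K := by rw [hKd]; exact IntermediateField.subset_adjoin _ _ (by simp)
  obtain ⟨g, hgd⟩ : ∃ g : K, (g : ℂ) = γ := ⟨⟨γ, hγK⟩, rfl⟩
  obtain ⟨z, hzd⟩ : ∃ z : K, (z : ℂ) = ζ := ⟨⟨ζ, hζK⟩, rfl⟩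
  have hg : g ^ 4 = 2 := by
    apply Subtype.ext; push_cast; rw [hgd, hγ]; rfl
  have hz : z ^ 4 = -1 := by
    apply Subtype.ext; push_cast; rw [hzd, hζ]
  apply fq_count g z hg hz
  obtain ⟨ι, h1, h2⟩ := fq_map (g ^ 2) (z ^ 2) (by linear_combination hg) (by linear_combination hz)
  have hr0 : fqR ≠ 0 := by
    intro h; have := fqR_sq; rw [h] at this; norm_num at this
  have hg0 : g ≠ 0 := by rintro rfl; norm_num at hg
  refine fq_main ι g h1.symm ?_
  have zmem : ∃ a : FqK, z = ι a := by
    have e : (g ^ 2 * z) ^ 2 = (1 + z ^ 2) ^ 2 := by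
      linear_combination z ^ 2 * hg - hz
    rcases sq_eq_sq_iff_eq_or_eq_neg.mp e with e | e
    · refine ⟨(1 + fqI) / fqR, ?_⟩
      rw [map_div₀, map_add, map_one, h1, h2]
      field_simp
      linear_combination e
    · refine ⟨-(1 + fqI) / fqR, ?_⟩
      rw [map_div₀, map_neg, map_add, map_one, h1, h2]
      field_simp
      linear_combination e
  have key : ∀ w ∈ IntermediateField.adjoin ℚ {γ, ζ}, ∃ a b : FqK, w = (ι a : ℂ) + (ι b : ℂ) * γ := by
    intro w hw
    have hγ2 : γ ^ 2 = (ι fqR : ℂ) := by rw [h1]; push_cast; rw [hgd]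
    induction hw using IntermediateField.adjoin_induction with
    | mem x hx =>
      rcases hx with rfl | rfl
      · exact ⟨0, 1, by simp⟩
      · obtain ⟨a, ha⟩ := zmem
        exact ⟨a, 0, by rw [← ha, ← hzd]; simp⟩
    | algebraMap q => exact ⟨q, 0, by simp⟩
    | add x y _ _ hx hy =>
      obtain ⟨a, b, rfl⟩ := hx
      obtain ⟨c, d, rfl⟩ := hy
      exact ⟨a + c, b + d, by simp only [map_add]; push_cast; ring⟩
    | mul x y _ _ hx hy =>
      obtain ⟨a, b, rfl⟩ := hx
      obtain ⟨c, d, rfl⟩ := hy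
      refine ⟨a * c + b * d * fqR, a * d + b * c, ?_⟩
      simp only [map_add, map_mul]; push_cast
      linear_combination (ι b : ℂ) * (ι d : ℂ) * hγ2
    | inv x _ hx =>
      obtain ⟨a, b, rfl⟩ := hx
      by_cases h0 : a ^ 2 - b ^ 2 * fqR = 0
      · have hb : b = 0 := by
          by_contra hb
          apply fqK_nr (a / b)
          field_simp
          linear_combination h0
        have ha : a = 0 := by
          rw [hb] at h0; simpa using h0
        exact ⟨0, 0, by simp [ha, hb]⟩
      · refine ⟨a / (a ^ 2 - b ^ 2 * fqR), -b / (a ^ 2 - b ^ 2 * fqR), ?_⟩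
        have hn : (((ι (a ^ 2 - b ^ 2 * fqR) : K)) : ℂ) ≠ 0 := by
          simpa only [ne_eq, ZeroMemClass.coe_eq_zero, map_eq_zero] using h0
        have hn2 : (((ι (a ^ 2 - b ^ 2 * fqR) : K)) : ℂ) = ((ι a : ℂ) + (ι b : ℂ) * γ) * ((ι a : ℂ) - (ι b : ℂ) * γ) := by
          simp only [map_sub, map_mul, map_pow]; push_cast
          linear_combination (ι b : ℂ) ^ 2 * hγ2
        have hn3 : (ι a : ℂ) + (ι b : ℂ) * γ ≠ 0 := by
          intro h; rw [h, zero_mul] at hn2; exact hn hn2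
        simp only [map_div₀, map_neg]; push_cast
        have : (ι a : ℂ) / (ι (a ^ 2 - b ^ 2 * fqR) : ℂ) + -(ι b : ℂ) / (ι (a ^ 2 - b ^ 2 * fqR) : ℂ) * γ
          = ((ι a : ℂ) - (ι b : ℂ) * γ) / (ι (a ^ 2 - b ^ 2 * fqR) : ℂ) := by ring
        rw [this, eq_div_iff hn, hn2]
        field_simp
  intro w
  obtain ⟨a, b, hab⟩ := key w (by rw [← hKd]; exact w.2)
  refine ⟨a, b, Subtype.ext ?_⟩
  rw [hab]; push_cast; rw [hgd]

/-- Let `K₁ = ℚ(2^{1/4}, ζ₈)` be the subfield of `ℂ` generated over `ℚ` by the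
real fourth root of `2` and by `ζ₈ = exp(2πi/8)`. Then the Fermat quartic
`x⁴ + y⁴ = 1` has exactly 56 affine points with coordinates in `K₁`. -/
theorem fermat_quartic_affine_points_two_fourth_root_zeta_eight :
    letI K₁ : IntermediateField ℚ ℂ :=
      IntermediateField.adjoin ℚ
        {(((2 : ℝ) ^ ((1 : ℝ) / 4) : ℝ) : ℂ), Complex.exp (2 * π * I / 8)}
    {p : K₁ × K₁ | p.1 ^ 4 + p.2 ^ 4 = 1}.ncard = 56 := by
  refine fq_final _ _ ?_ ?_ _ rfl
  · rw [← Complex.ofReal_pow, ← Real.rpow_natCast, ← Real.rpow_mul (by norm_num)]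
    norm_num
  · rw [← Complex.exp_nat_mul]
    have : ((4 : ℕ) : ℂ) * (2 * π * I / 8) = π * I := by push_cast; ring
    rw [this, Complex.exp_pi_mul_I]
end

section
/- Let K₂ be the 24-th cyclotomic field ℚ(ζ₂₄) (which equals ℚ(ζ₃, ζ₈)). Then the set {(x, y) ∈ K₂ × K₂ | x⁴ + y⁴ = 1} has exactly 40 elements. -/
set_option linter.unusedSimpArgs false

lemma aux_no44_coprime {p q r s : ℤ} (hpq : Int.gcd p q = 1) (hp : p % 2 = 0) (hs : s ^ 2 = 2 * p * q)
    (hr : r ^ 2 = p ^ 2 + q ^ 2) (hs0 : s ≠ 0) : ∃ e f : ℤ, e ≠ 0 ∧ f ≠ 0 ∧ f ^ 4 + 4 * e ^ 4 = r ^ 2 := by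
  obtain ⟨p', rfl⟩ : (2:ℤ) ∣ p := Int.dvd_of_emod_eq_zero hp
  have h2s : (2:ℤ) ∣ s := by
    apply @Int.Prime.dvd_pow' _ 2 _ Nat.prime_two
    rw [hs]; exact ⟨2 * p' * q, by push_cast; ring⟩
  obtain ⟨s', rfl⟩ := h2s
  have h1 : p' * q = s' ^ 2 := by linarith
  have hg : Int.gcd p' q = 1 := by
    rw [← Int.isCoprime_iff_gcd_eq_one] at hpq ⊢
    exact hpq.of_mul_left_right
  obtain ⟨e, he⟩ := Int.sq_of_gcd_eq_one hg h1
  rw [mul_comm] at h1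
  rw [Int.gcd_comm] at hg
  obtain ⟨f, hf⟩ := Int.sq_of_gcd_eq_one hg h1
  refine ⟨e, f, ?_, ?_, ?_⟩
  · rintro rfl
    have : p' = 0 := by simpa using he
    rw [this] at h1
    have : s' = 0 := by simpa using h1.symm
    simp [this] at hs0
  · rintro rfl
    have : q = 0 := by simpa using hf
    rw [this] at h1
    have : s' = 0 := by simpa using h1.symm
    simp [this] at hs0
  · grind

lemma aux_no44 (N : ℕ) : ∀ a b c : ℤ, c.natAbs = N → a ≠ 0 → b ≠ 0 → a ^ 4 + 4 * b ^ 4 = c ^ 2 → False := by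
  induction N using Nat.strong_induction_on with
  | _ N ih =>
  intro a b c hc ha hb h
  wlog hc0 : 0 ≤ c generalizing c
  · exact this (-c) (by simpa using hc) (by simpa using h) (by linarith)
  have hcpos : 0 < c := by
    rcases hc0.lt_or_eq with h1 | h1
    · exact h1
    · subst h1
      have : 0 < a ^ 4 := by positivity
      have : 0 < b ^ 4 := by positivity
      nlinarith
  -- coprimality
  by_cases hab : IsCoprime a b
  swap
  · rw [Int.isCoprime_iff_gcd_eq_one] at hab
    obtain ⟨p, hp, hpa, hpb⟩ := Nat.Prime.not_coprime_iff_dvd.mp hab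
    obtain ⟨a1, rfl⟩ := Int.natCast_dvd.mpr hpa
    obtain ⟨b1, rfl⟩ := Int.natCast_dvd.mpr hpb
    have hpc : (p : ℤ) ^ 2 ∣ c := by
      rw [← Int.pow_dvd_pow_iff two_ne_zero, ← h]
      apply Dvd.intro (a1 ^ 4 + 4 * b1 ^ 4)
      ring
    obtain ⟨c1, rfl⟩ := hpc
    have hp0 : (p:ℤ) ≠ 0 := by exact_mod_cast hp.ne_zero
    refine ih c1.natAbs ?_ a1 b1 c1 rfl (right_ne_zero_of_mul ha) (right_ne_zero_of_mul hb) ?_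
    · rw [← hc, Int.natAbs_mul, lt_mul_iff_one_lt_left, Int.natAbs_pow, Int.natAbs_natCast]
      · exact Nat.one_lt_pow two_ne_zero (Nat.Prime.one_lt hp)
      · apply Nat.pos_of_ne_zero
        rw [Int.natAbs_ne_zero]
        exact right_ne_zero_of_mul hcpos.ne'
    · have : (p:ℤ)^4 ≠ 0 := pow_ne_zero _ hp0
      apply mul_left_cancel₀ this
      linear_combination h
  rcases Int.emod_two_eq_zero_or_one a with ha2 | ha2
  · obtain ⟨a1, rfl⟩ : (2:ℤ) ∣ a := Int.dvd_of_emod_eq_zero ha2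
    have h2c : (2:ℤ) ∣ c := by
      apply @Int.Prime.dvd_pow' _ 2 _ Nat.prime_two
      rw [← h]; exact ⟨8 * a1 ^ 4 + 2 * b ^ 4, by push_cast; ring⟩
    obtain ⟨c1, rfl⟩ := h2c
    exact ih c1.natAbs (by omega) b a1 c1 rfl hb (by simpa using ha) (by linarith)
  have ht : PythagoreanTriple (a ^ 2) (2 * b ^ 2) c := by
    delta PythagoreanTriple
    linear_combination h
  have ha22 : a ^ 2 % 2 = 1 := by
    rw [sq, Int.mul_emod, ha2]; decide
  have h2 : Int.gcd (a ^ 2) (2 * b ^ 2) = 1 := by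
    rw [← Int.isCoprime_iff_gcd_eq_one]
    refine IsCoprime.mul_right ?_ hab.pow
    exact ⟨1, -(a ^ 2 / 2), by omega⟩
  obtain ⟨m, n, ht1, ht2, ht3, ht4, ht5, ht6⟩ := ht.coprime_classification' h2 ha22 hcpos
  have hmn : m * n = b ^ 2 := by linarith
  have hm : 0 < m := by
    apply lt_of_le_of_ne ht6
    rintro rfl
    exact pow_ne_zero 2 hb (by linarith)
  have hn : 0 < n := by
    have : 0 < b ^ 2 := by positivity
    nlinarith
  have ht4' : Int.gcd n m = 1 := by rwa [Int.gcd_comm]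
  obtain ⟨r, hr⟩ := Int.sq_of_gcd_eq_one ht4 hmn
  obtain ⟨s, hs⟩ := Int.sq_of_gcd_eq_one ht4' (by rwa [mul_comm])
  replace hr : m = r ^ 2 := hr.resolve_right (by nlinarith [sq_nonneg r])
  replace hs : n = s ^ 2 := hs.resolve_right (by nlinarith [sq_nonneg s])
  have htt : PythagoreanTriple a n m := by
    delta PythagoreanTriple
    linear_combination ht1
  have h3 : Int.gcd a n = 1 := by
    apply Int.isCoprime_iff_gcd_eq_one.mp
    apply @IsCoprime.of_mul_left_left _ _ _ a
    rw [← sq, ht1, (by ring : m ^ 2 - n ^ 2 = m ^ 2 + -n * n)]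
    exact (Int.isCoprime_iff_gcd_eq_one.mpr ht4).pow_left.add_mul_right_left (-n)
  obtain ⟨p, q, _, htt2, htt3, htt4, htt5, htt6⟩ := htt.coprime_classification' h3 ha2 hm
  have hs0 : s ≠ 0 := by rintro rfl; simp at hs; omega
  have key : ∃ e f : ℤ, e ≠ 0 ∧ f ≠ 0 ∧ f ^ 4 + 4 * e ^ 4 = r ^ 2 := by
    rcases htt5 with ⟨h5, _⟩ | ⟨_, h5⟩
    · exact aux_no44_coprime (s := s) htt4 h5 (by rw [← hs, htt2]) (by rw [← hr, htt3]) hs0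
    · exact aux_no44_coprime (s := s) (by rwa [Int.gcd_comm]) h5 (by rw [← hs, htt2]; ring)
        (by rw [← hr, htt3]; ring) hs0
  obtain ⟨e, f, he, hf, hef⟩ := key
  refine ih r.natAbs ?_ f e r rfl hf he hef
  rw [← hc]
  apply Int.ofNat_lt.mp
  rw [← Int.eq_natAbs_of_nonneg hc0]
  apply lt_of_le_of_lt (Int.natAbs_le_self_sq r)
  rw [← hr, ht3]
  apply lt_of_le_of_lt (Int.le_self_sq m)
  exact lt_add_of_pos_right (m ^ 2) (by positivity)

lemma no_four {a : ℚ} {c : ℚ} (ha : a ≠ 0) (h : a ^ 4 + 4 = c ^ 2) : False := by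
  have ha' := a.num_div_den
  have hc' := c.num_div_den
  have hd : (a.den : ℚ) ≠ 0 := by exact_mod_cast a.den_nz
  have he : (c.den : ℚ) ≠ 0 := by exact_mod_cast c.den_nz
  refine aux_no44 _ (a.num * c.den) (a.den * c.den) (c.num * a.den ^ 2 * c.den) rfl ?_ ?_ ?_
  · have := Rat.num_ne_zero.mpr ha
    have := c.den_nz
    positivity
  · have := a.den_nz
    have := c.den_nz
    positivity
  · have : ((a.num * c.den) ^ 4 + 4 * (a.den * c.den) ^ 4 : ℚ) = (c.num * a.den ^ 2 * c.den) ^ 2 := by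
      have e1 : (a.num : ℚ) = a * a.den := by field_simp at ha'; linarith
      have e2 : (c.num : ℚ) = c * c.den := by field_simp at hc'; linarith
      rw [e1, e2]
      linear_combination (a.den:ℚ)^4 * (c.den:ℚ)^4 * h
    exact_mod_cast this

lemma no_one {a : ℚ} {c : ℚ} (ha : a ≠ 0) (h : a ^ 4 + 1 = c ^ 2) : False := by
  have ha' := a.num_div_den
  have hc' := c.num_div_den
  have hd : (a.den : ℚ) ≠ 0 := by exact_mod_cast a.den_nz
  have he : (c.den : ℚ) ≠ 0 := by exact_mod_cast c.den_nz
  refine @not_fermat_42 (a.num * c.den) (a.den * c.den) (c.num * a.den ^ 2 * c.den) ?_ ?_ ?_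
  · have := Rat.num_ne_zero.mpr ha
    have := c.den_nz
    positivity
  · have := a.den_nz
    have := c.den_nz
    positivity
  · have : ((a.num * c.den) ^ 4 + (a.den * c.den) ^ 4 : ℚ) = (c.num * a.den ^ 2 * c.den) ^ 2 := by
      have e1 : (a.num : ℚ) = a * a.den := by field_simp at ha'; linarith
      have e2 : (c.num : ℚ) = c * c.den := by field_simp at hc'; linarith
      rw [e1, e2]
      linear_combination (a.den:ℚ)^4 * (c.den:ℚ)^4 * h
    exact_mod_cast this

lemma rat_E1 {x y : ℚ} (h : y ^ 2 = x ^ 3 - x) : y = 0 := by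
  by_contra hy
  have hx : x ≠ 0 := by rintro rfl; apply hy; simpa using h
  refine no_four (a := y / x) (c := x + 1 / x) (div_ne_zero hy hx) ?_
  field_simp
  linear_combination (y ^ 2 + (x ^ 3 - x)) * h

lemma rat_E2 {x y : ℚ} (h : 2 * y ^ 2 = x ^ 3 - x) : y = 0 := by
  by_contra hy
  have hx : x ≠ 0 := by rintro rfl; apply hy; simpa using h
  refine no_one (a := y / x) (c := (x + 1 / x) / 2) (div_ne_zero hy hx) ?_
  field_simp
  linear_combination (2 * y ^ 2 + (x ^ 3 - x)) * h

/-- 3-adic descent -/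
lemma three_aux (a b : ℤ) (h : 3 ∣ a ^ 2 + b ^ 2) : 3 ∣ a ∧ 3 ∣ b := by
  have key2 : ∀ a b : ZMod 3, a^2+b^2=0 → a = 0 ∧ b = 0 := by decide
  have := key2 a b (by
    have := (ZMod.intCast_zmod_eq_zero_iff_dvd (a^2+b^2) 3).2 (by exact_mod_cast h)
    push_cast at this; exact this)
  rw [ZMod.intCast_zmod_eq_zero_iff_dvd, ZMod.intCast_zmod_eq_zero_iff_dvd] at this
  exact_mod_cast this

lemma three_descent_step {p1 q1 p2 q2 p3 q3 : ℤ}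
    (h1 : p1^2 - 2*q1^2 - 3*(p2^2 - 2*q2^2) + (p3^2-2*q3^2) = 0)
    (h2 : p1*q1 - 3*(p2*q2) + p3*q3 = 0) :
    3 ∣ p1 ∧ 3 ∣ q1 ∧ 3 ∣ p2 ∧ 3 ∣ q2 ∧ 3 ∣ p3 ∧ 3 ∣ q3 := by
  have k1 := three_aux (p1 + q1) (p3 + q3)
    ⟨q1^2 + q3^2 + (p2^2-2*q2^2) + 2 * (p2*q2), by linear_combination h1 + 2 * h2⟩
  have k2 := three_aux (p1 - q1) (p3 - q3)
    ⟨q1^2 + q3^2 + (p2^2-2*q2^2) - 2 * (p2*q2), by linear_combination h1 - 2 * h2⟩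
  have a : 3 ∣ p1 := by omega
  have b : 3 ∣ q1 := by omega
  have c : 3 ∣ p3 := by omega
  have d : 3 ∣ q3 := by omega
  have : 3 ∣ p2 ∧ 3 ∣ q2 := by
    obtain ⟨a, rfl⟩ := a
    obtain ⟨b, rfl⟩ := b
    obtain ⟨c, rfl⟩ := c
    obtain ⟨d, rfl⟩ := d
    exact three_aux p2 q2 ⟨a^2-2*b^2+c^2-2*d^2 + q2^2, by linarith⟩
  exact ⟨a, b, this.1, this.2, c, d⟩

lemma three_descent (N : ℕ) : ∀ p1 q1 p2 q2 p3 q3 : ℤ,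
    p3.natAbs + q3.natAbs = N →
    (p1^2 - 2*q1^2 - 3*(p2^2 - 2*q2^2) + (p3^2-2*q3^2) = 0) →
    (p1*q1 - 3*(p2*q2) + p3*q3 = 0) → p3 = 0 ∧ q3 = 0 := by
  induction N using Nat.strong_induction_on with
  | _ N ih =>
  intro p1 q1 p2 q2 p3 q3 hN h1 h2
  obtain ⟨⟨a, rfl⟩, ⟨b, rfl⟩, ⟨c, rfl⟩, ⟨d, rfl⟩, ⟨e, rfl⟩, ⟨f, rfl⟩⟩ := three_descent_step h1 h2
  by_cases h : e.natAbs + f.natAbs = 0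
  · omega
  have := ih (e.natAbs + f.natAbs) (by omega) a b c d e f rfl (by linarith) (by linarith)
  omega

lemma three_rat {p1 q1 p2 q2 p3 q3 : ℚ}
    (h1 : p1^2 - 2*q1^2 - 3*(p2^2 - 2*q2^2) + (p3^2-2*q3^2) = 0)
    (h2 : p1*q1 - 3*(p2*q2) + p3*q3 = 0) : p3 = 0 ∧ q3 = 0 := by
  obtain ⟨⟨d, hd⟩, hD⟩ := IsLocalization.exist_integer_multiples_of_finset (nonZeroDivisors ℤ)
    ({p1, q1, p2, q2, p3, q3} : Finset ℚ)
  have hd0 : (d : ℚ) ≠ 0 := by simpa using hd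
  simp only [Finset.mem_insert, Finset.mem_singleton, forall_eq_or_imp, forall_eq, IsLocalization.IsInteger] at hD
  obtain ⟨⟨a, ha⟩, ⟨b, hb⟩, ⟨c, hc⟩, ⟨e, he⟩, ⟨f, hf⟩, ⟨g, hg⟩⟩ := hD
  simp at ha hb hc he hf hg
  have := three_descent _ a b c e f g rfl
    (by have : ((a^2 - 2*b^2 - 3*(c^2 - 2*e^2) + (f^2-2*g^2) : ℤ) : ℚ) = 0 := by
          push_cast; rw [ha, hb, hc, he, hf, hg]; linear_combination (d:ℚ)^2 * h1
        exact_mod_cast this)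
    (by have : ((a*b - 3*(c*e) + f*g : ℤ) : ℚ) = 0 := by
          push_cast; rw [ha, hb, hc, he, hf, hg]; linear_combination (d:ℚ)^2 * h2
        exact_mod_cast this)
  rw [this.1] at hf
  rw [this.2] at hg
  simpa [hd0] using And.intro hf.symm hg.symm

open WeierstrassCurve

/-- The curve `y^2 = x^3 - x`. -/
def E32 : WeierstrassCurve ℚ := ⟨0, 0, 0, -1, 0⟩

/-- Points of `E32` over a field. -/
abbrev EPt (K : Type*) [Field K] [Algebra ℚ K] := (E32.baseChange K).toAffine.Point

section curve
variable {K : Type*} [Field K] [Algebra ℚ K]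

lemma E32_eqn {x y : K} (h : (E32.baseChange K).toAffine.Nonsingular x y) : y ^ 2 = x ^ 3 - x := by
  have h1 := h.1
  rw [Affine.equation_iff] at h1
  simp [E32] at h1
  linear_combination h1

lemma E32_ns {x y : K} (h : y ^ 2 = x ^ 3 - x) : (E32.baseChange K).toAffine.Nonsingular x y := by
  have : CharZero K := algebraRat.charZero K
  rw [Affine.nonsingular_iff, Affine.equation_iff]
  simp [E32]
  refine ⟨by linear_combination h, ?_⟩
  by_contra hc
  push Not at hc
  obtain ⟨h1, h2⟩ := hc
  have hy : y = 0 := by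
    have : (2:K) * y = 0 := by linear_combination h2
    simpa using this
  subst hy
  have h3 : x * (x^2 - 1) = 0 := by linear_combination -h
  have h4 : 3 * x^2 = 1 := by linear_combination -h1
  have h5 : (2:K) * x = 0 := by linear_combination -3 * h3 + x * h4 
  have h6 : x = 0 := by simpa using h5
  subst h6
  simp at h4

lemma E32_neg {x y : K} (h : (E32.baseChange K).toAffine.Nonsingular x y) :
    -(Affine.Point.some x y h) = Affine.Point.some x (-y) (E32_ns (by
      have := E32_eqn h; linear_combination this)) := by
  rw [Affine.Point.neg_some]
  simp [Affine.negY, E32]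

variable [DecidableEq K]

lemma E32_add {x1 y1 x2 y2 x3 y3 : K} {h1 : (E32.baseChange K).toAffine.Nonsingular x1 y1}
    {h2 : (E32.baseChange K).toAffine.Nonsingular x2 y2}
    {h3 : (E32.baseChange K).toAffine.Nonsingular x3 y3}
    (h : Affine.Point.some x1 y1 h1 + Affine.Point.some x2 y2 h2 = Affine.Point.some x3 y3 h3) :
    ∃ l, ((x1 ≠ x2 ∧ l = (y1 - y2) / (x1 - x2)) ∨
      (x1 = x2 ∧ y1 = y2 ∧ y1 ≠ 0 ∧ l = (3 * x1 ^ 2 - 1) / (2 * y1))) ∧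
      x3 = l ^ 2 - x1 - x2 ∧ y3 = -(y1 + l * (x3 - x1)) := by
  have : CharZero K := algebraRat.charZero K
  by_cases hxy : x1 = x2 ∧ y1 = (E32.baseChange K).toAffine.negY x2 y2
  · rw [Affine.Point.add_of_Y_eq hxy.1 hxy.2] at h
    exact absurd h.symm (Affine.Point.some_ne_zero _)
  rw [Affine.Point.add_some hxy] at h
  simp only [Affine.Point.some.injEq] at h
  obtain ⟨hx, hy⟩ := h
  refine ⟨(E32.baseChange K).toAffine.slope x1 x2 y1 y2, ?_, ?_, ?_⟩
  · by_cases hx12 : x1 = x2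
    · right
      have hy' : y1 ≠ (E32.baseChange K).toAffine.negY x2 y2 := fun h => hxy ⟨hx12, h⟩
      have hyy := Affine.Y_eq_of_Y_ne h1.1 h2.1 hx12 hy'
      have hy0 : y1 ≠ 0 := by
        rintro rfl
        apply hy'
        simp [Affine.negY, E32, ← hyy]
      refine ⟨hx12, hyy, hy0, ?_⟩
      rw [Affine.slope_of_Y_ne hx12 hy']
      simp [Affine.negY, E32]
      ring
    · left
      exact ⟨hx12, by rw [Affine.slope_of_X_ne hx12]⟩
  · rw [← hx]; simp [Affine.addX, E32]
  · rw [← hy, ← hx]; simp [Affine.addX, Affine.addY, Affine.negAddY, Affine.negY, E32]; ring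

lemma E32_add_eq_zero {x1 y1 x2 y2 : K} {h1 : (E32.baseChange K).toAffine.Nonsingular x1 y1}
    {h2 : (E32.baseChange K).toAffine.Nonsingular x2 y2}
    (h : Affine.Point.some x1 y1 h1 + Affine.Point.some x2 y2 h2 = 0) :
    x2 = x1 ∧ y2 = - y1 := by
  have := eq_neg_of_add_eq_zero_right h
  rw [E32_neg] at this
  simpa using this

lemma E32_double_zero {x y : K} {h : (E32.baseChange K).toAffine.Nonsingular x y} :
    Affine.Point.some x y h + Affine.Point.some x y h = 0 ↔ y = 0 := by
  have : CharZero K := algebraRat.charZero K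
  constructor
  · intro h
    have := (E32_add_eq_zero h).2
    have : (2:K) * y = 0 := by linear_combination this
    simpa using this
  · rintro rfl
    apply Affine.Point.add_of_Y_eq rfl
    simp [Affine.negY, E32]

/-- x-coordinates of points of order 4 -/
lemma E32_four {x y : K} {h : (E32.baseChange K).toAffine.Nonsingular x y}
    (h4 : (Affine.Point.some x y h + Affine.Point.some x y h) +
      (Affine.Point.some x y h + Affine.Point.some x y h) = 0)
    (h2 : (Affine.Point.some x y h + Affine.Point.some x y h) ≠ 0) :
    x ^ 2 = -1 ∨ (x - 1) ^ 2 = 2 ∨ (x + 1) ^ 2 = 2 := by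
  have : CharZero K := algebraRat.charZero K
  have hE := E32_eqn h
  have hy0 : y ≠ 0 := fun h' => h2 (E32_double_zero.2 h')
  rcases h' : (Affine.Point.some x y h + Affine.Point.some x y h) with _ | ⟨x3, y3, h3⟩
  · exact absurd h' h2
  rw [h'] at h4
  have hy3 := E32_double_zero.1 h4
  subst hy3
  obtain ⟨l, hl, hx3, -⟩ := E32_add h'
  have hl : l = (3 * x ^ 2 - 1) / (2 * y) := by
    rcases hl with hl | hl
    · exact absurd rfl hl.1
    · exact hl.2.2.2
  have hx3' : x3 * (4 * y ^ 2) = (x ^ 2 + 1) ^ 2 := by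
    rw [hx3, hl]; field_simp
    linear_combination (-32 * x) * hE
  have h3' := E32_eqn h3
  have h3'' : x3 * ((x3 - 1) * (x3 + 1)) = 0 := by linear_combination -h3'
  rcases mul_eq_zero.1 h3'' with h5 | h5
  · left
    rw [h5] at hx3'
    have : x ^ 2 + 1 = 0 := by simpa using hx3'.symm
    linear_combination this
  rcases mul_eq_zero.1 h5 with h5 | h5
  · right; left
    have h6 : x3 = 1 := by linear_combination h5
    rw [h6, hE] at hx3'
    have : (x ^ 2 - 2 * x - 1) ^ 2 = 0 := by linear_combination -hx3'
    have : (x ^ 2 - 2 * x - 1) = 0 := by simpa using this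
    linear_combination this
  · right; right
    have h6 : x3 = -1 := by linear_combination h5
    rw [h6, hE] at hx3'
    have : (x ^ 2 + 2 * x - 1) ^ 2 = 0 := by linear_combination -hx3'
    have : (x ^ 2 + 2 * x - 1) = 0 := by simpa using this
    linear_combination this

end curve

/-- The Galois data of the 24-th cyclotomic field used in the proof. -/
structure GData (K : Type*) [Field K] [Algebra ℚ K] where
  s : K →ₐ[ℚ] K
  t : K →ₐ[ℚ] K
  u : K →ₐ[ℚ] K
  ss : ∀ x, s (s x) = x
  tt : ∀ x, t (t x) = x
  uu : ∀ x, u (u x) = x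
  ts : ∀ x, t (s x) = s (t x)
  us : ∀ x, u (s x) = s (u x)
  ut : ∀ x, u (t x) = t (u x)
  i : K
  a : K
  b : K
  hi : i ^ 2 = -1
  ha : a ^ 2 = 2
  hb : b ^ 2 = 3
  si : s i = i
  ti : t i = -i
  ui : u i = i
  sa : s a = a
  ta : t a = a
  ua : u a = -a
  sb : s b = -b
  tb : t b = b
  ub : u b = b
  fix : ∀ x, s x = x → t x = x → u x = x → ∃ q : ℚ, x = algebraMap ℚ K q

namespace GData
variable {K : Type*} [Field K] [Algebra ℚ K] (G : GData K)

lemma i0 : G.i ≠ 0 := by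
  intro h; have := G.hi; simp [h] at this

lemma a0 : G.a ≠ 0 := by
  have : CharZero K := algebraRat.charZero K
  intro h; have := G.ha; simp [h] at this

lemma b0 : G.b ≠ 0 := by
  have : CharZero K := algebraRat.charZero K
  intro h; have := G.hb; simp [h] at this

lemma rat_y {x y d : K} {D : ℚ} (hd : d ^ 2 = algebraMap ℚ K D) (hd0 : d ≠ 0) (h : y ^ 2 = x ^ 3 - x)
    (hD : D = 1 ∨ D = 2 ∨ D = -1 ∨ D = -2)
    (hx : G.s x = x ∧ G.t x = x ∧ G.u x = x)
    (hy : G.s (y / d) = y / d ∧ G.t (y / d) = y / d ∧ G.u (y / d) = y / d) : y = 0 := by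
  obtain ⟨q, hq⟩ := G.fix x hx.1 hx.2.1 hx.2.2
  obtain ⟨r, hr⟩ := G.fix _ hy.1 hy.2.1 hy.2.2
  have hy' : y = d * algebraMap ℚ K r := by rw [← hr]; field_simp
  have h2 : D * r ^ 2 = q ^ 3 - q := by
    apply (algebraMap ℚ K).injective
    simp only [map_mul, map_pow, map_sub]
    rw [← hq, ← h, hy', mul_pow, hd]
  have hr0 : r = 0 := by
    rcases hD with rfl | rfl | rfl | rfl
    · exact rat_E1 (x := q) (by linarith)
    · exact rat_E2 (x := q) (by linarith)
    · exact rat_E1 (x := -q) (by linarith)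
    · exact rat_E2 (x := -q) (by linarith)
  rw [hy', hr0]; simp

lemma s2 : G.s 2 = 2 := map_ofNat G.s 2
lemma t2 : G.t 2 = 2 := map_ofNat G.t 2
lemma u2 : G.u 2 = 2 := map_ofNat G.u 2

/-- elements fixed by `s` and `t ∘ u` -/
lemma fixF (x : K) (hs : G.s x = x) (hr : G.t (G.u x) = x) :
    ∃ p q : ℚ, x = algebraMap ℚ K p + algebraMap ℚ K q * (G.i * G.a) := by
  have : CharZero K := algebraRat.charZero K
  have hi0 := G.i0
  have ha0 := G.a0
  have hut : G.u x = G.t x := by rw [← G.tt (G.u x), hr]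
  obtain ⟨p, hp⟩ := G.fix ((x + G.t x) / 2) (by simp [G.s2, G.t2, G.u2, ← G.ts, hs])
    (by simp [G.s2, G.t2, G.u2, G.tt, add_comm]) (by simp [G.s2, G.t2, G.u2, hut, G.ut, G.tt, add_comm])
  obtain ⟨q, hq⟩ := G.fix ((x - G.t x) / (2 * (G.i * G.a))) (by simp [G.s2, G.t2, G.u2, ← G.ts, hs, G.si, G.sa])
    (by simp [G.s2, G.t2, G.u2, G.tt, G.ti, G.ta]; field_simp; ring) (by simp [G.s2, G.t2, G.u2, hut, G.ut, G.tt, G.ui, G.ua]; field_simp; ring)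
  refine ⟨p, q, ?_⟩
  rw [← hp, ← hq]
  field_simp
  ring

/-- the local obstruction at 3 -/
lemma norm_obstruction (z c : K) (hs : G.s c = c) (hr : G.t (G.u c) = c)
    (h : z * G.s z * G.t (G.u (z * G.s z)) = - c ^ 2) : z = 0 := by
  have : CharZero K := algebraRat.charZero K
  have hb0 := G.b0
  have ha0 := G.a0
  have hi0 := G.i0
  have hw : ∀ w, G.t (G.u (G.t (G.u w))) = w := fun w => by rw [G.ut, G.tt, G.uu]
  set w := z * G.t (G.u z) with hwdef
  have hrw : G.t (G.u w) = w := by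
    rw [hwdef]; simp [hw, mul_comm]
  have hcomm : ∀ v, G.t (G.u (G.s v)) = G.s (G.t (G.u v)) := fun v => by rw [G.us, G.ts]
  obtain ⟨p1, q1, h1⟩ := G.fixF ((w + G.s w) / 2) (by simp [G.s2, G.t2, G.u2, G.ss, add_comm]) (by simp [G.s2, G.t2, G.u2, hcomm, hrw])
  obtain ⟨p2, q2, h2⟩ := G.fixF ((w - G.s w) / (2 * G.b)) (by simp [G.s2, G.t2, G.u2, G.ss, G.sb]; field_simp; ring)
    (by simp [G.s2, G.t2, G.u2, hcomm, hrw, G.tb, G.ub])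
  obtain ⟨p3, q3, h3⟩ := G.fixF c hs hr
  have hnorm : w * G.s w = - c ^ 2 := by
    rw [← h, hwdef]; simp [hcomm]; ring
  have hiden : ((w + G.s w) / 2) ^ 2 - 3 * ((w - G.s w) / (2 * G.b)) ^ 2 + c ^ 2 = 0 := by
    rw [← neg_neg (c ^ 2), ← hnorm]
    field_simp
    rw [G.hb]; ring
  rw [h1, h2, h3] at hiden
  set d := G.i * G.a with hd
  have hd2 : d ^ 2 = -2 := by rw [hd, mul_pow, G.hi, G.ha]; ring
  have e : algebraMap ℚ K (p1^2 - 2*q1^2 - 3*(p2^2 - 2*q2^2) + (p3^2-2*q3^2)) +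
      algebraMap ℚ K (2 * (p1*q1 - 3*(p2*q2) + p3*q3)) * d = 0 := by
    simp only [map_add, map_sub, map_mul, map_pow, map_ofNat]
    linear_combination hiden + (-(algebraMap ℚ K q1)^2 + 3 * (algebraMap ℚ K q2)^2 - (algebraMap ℚ K q3)^2) * hd2
  have hind : ∀ A B : ℚ, algebraMap ℚ K A + algebraMap ℚ K B * d = 0 → A = 0 ∧ B = 0 := by
    intro A B hAB
    have hAB' := congrArg G.t hAB
    have htd : G.t d = -d := by simp [hd, G.ti, G.ta]
    simp [htd] at hAB'
    have hd0 : d ≠ 0 := mul_ne_zero hi0 ha0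
    have hA : (2:K) * (A:K) = 0 := by simp at hAB; linear_combination hAB + hAB'
    have hA' : A = 0 := by simpa using hA
    subst hA'
    simpa [hd0] using hAB
  obtain ⟨e1, e2⟩ := hind _ _ e
  obtain ⟨e3, e4⟩ := three_rat e1 (by linarith)
  have hc : c = 0 := by rw [h3, e3, e4]; simp
  rw [hc] at h
  simpa using h

variable [DecidableEq K]

/-- action on points -/
noncomputable def S : EPt K →+ EPt K := Affine.Point.map (W' := E32) G.s
noncomputable def T : EPt K →+ EPt K := Affine.Point.map (W' := E32) G.t
noncomputable def U : EPt K →+ EPt K := Affine.Point.map (W' := E32) G.u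

lemma S_some {x y : K} (h : (E32.baseChange K).toAffine.Nonsingular x y) :
    G.S (Affine.Point.some x y h) = Affine.Point.some (G.s x) (G.s y)
     ((Affine.baseChange_nonsingular E32.toAffine G.s.injective ..).mpr h) := rfl
lemma T_some {x y : K} (h : (E32.baseChange K).toAffine.Nonsingular x y) :
    G.T (Affine.Point.some x y h) = Affine.Point.some (G.t x) (G.t y)
     ((Affine.baseChange_nonsingular E32.toAffine G.t.injective ..).mpr h) := rfl
lemma U_some {x y : K} (h : (E32.baseChange K).toAffine.Nonsingular x y) :
    G.U (Affine.Point.some x y h) = Affine.Point.some (G.u x) (G.u y)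
     ((Affine.baseChange_nonsingular E32.toAffine G.u.injective ..).mpr h) := rfl

lemma SS (P : EPt K) : G.S (G.S P) = P := by
  rcases P with _ | ⟨x, y, h⟩
  · rfl
  · simp [S_some, G.ss]
lemma TT (P : EPt K) : G.T (G.T P) = P := by
  rcases P with _ | ⟨x, y, h⟩
  · rfl
  · simp [T_some, G.tt]
lemma UU (P : EPt K) : G.U (G.U P) = P := by
  rcases P with _ | ⟨x, y, h⟩
  · rfl
  · simp [U_some, G.uu]
lemma TS (P : EPt K) : G.T (G.S P) = G.S (G.T P) := by
  rcases P with _ | ⟨x, y, h⟩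
  · rfl
  · simp [S_some, T_some, G.ts]
lemma US (P : EPt K) : G.U (G.S P) = G.S (G.U P) := by
  rcases P with _ | ⟨x, y, h⟩
  · rfl
  · simp [S_some, U_some, G.us]
lemma UT (P : EPt K) : G.U (G.T P) = G.T (G.U P) := by
  rcases P with _ | ⟨x, y, h⟩
  · rfl
  · simp [T_some, U_some, G.ut]

lemma part_zero (P : EPt K) (hs : G.S P = P) (ht : G.T P = P ∨ G.T P = -P)
    (hu : G.U P = P ∨ G.U P = -P) : P + P = 0 := by
  rcases P with _ | ⟨x, y, h⟩
  · rfl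
  rw [E32_double_zero]
  have hE := E32_eqn h
  rw [E32_neg, S_some] at *
  rw [T_some] at ht
  rw [U_some] at hu
  simp only [Affine.Point.some.injEq] at hs ht hu
  have hi0 := G.i0
  have ha0 := G.a0
  rcases ht with ht | ht <;> rcases hu with hu | hu
  · exact G.rat_y (d := 1) (D := 1) (by simp) (by simp) hE (by simp) ⟨hs.1, ht.1, hu.1⟩
      (by simp [hs, ht, hu])
  · exact G.rat_y (d := G.a) (D := 2) (by simp [G.ha]) ha0 hE (by simp) ⟨hs.1, ht.1, hu.1⟩
      (by simp [hs, ht, hu, G.sa, G.ta, G.ua])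
  · exact G.rat_y (d := G.i) (D := -1) (by simp [G.hi]) hi0 hE (by simp) ⟨hs.1, ht.1, hu.1⟩
      (by simp [hs, ht, hu, G.si, G.ti, G.ui])
  · exact G.rat_y (d := G.i * G.a) (D := -2) (by simp [mul_pow, G.hi, G.ha]) (mul_ne_zero hi0 ha0)
      hE (by simp) ⟨hs.1, ht.1, hu.1⟩
      (by simp [hs, ht, hu, G.sa, G.ta, G.ua, G.si, G.ti, G.ui])

lemma eight (P : EPt K) (hs : G.S P = P) : (8 : ℕ) • P = 0 := by
  have h1 := G.part_zero (P + G.T P + G.U P + G.T (G.U P))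
    (by simp only [map_add, map_sub, ← G.TS, ← G.US, hs])
    (by left; simp only [map_add, map_sub, G.TT]; abel)
    (by left; simp only [map_add, map_sub, G.UT, G.UU]; abel)
  have h2 := G.part_zero (P + G.T P - G.U P - G.T (G.U P))
    (by simp only [map_add, map_sub, ← G.TS, ← G.US, hs])
    (by left; simp only [map_add, map_sub, G.TT]; abel)
    (by right; simp only [map_add, map_sub, G.UT, G.UU]; abel)
  have h3 := G.part_zero (P - G.T P + G.U P - G.T (G.U P))
    (by simp only [map_add, map_sub, ← G.TS, ← G.US, hs])
    (by right; simp only [map_add, map_sub, G.TT]; abel)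
    (by left; simp only [map_add, map_sub, G.UT, G.UU]; abel)
  have h4 := G.part_zero (P - G.T P - G.U P + G.T (G.U P))
    (by simp only [map_add, map_sub, ← G.TS, ← G.US, hs])
    (by right; simp only [map_add, map_sub, G.TT]; abel)
    (by right; simp only [map_add, map_sub, G.UT, G.UU]; abel)
  calc (8 : ℕ) • P = (P + G.T P + G.U P + G.T (G.U P) + (P + G.T P + G.U P + G.T (G.U P)))
      + (P + G.T P - G.U P - G.T (G.U P) + (P + G.T P - G.U P - G.T (G.U P)))
      + (P - G.T P + G.U P - G.T (G.U P) + (P - G.T P + G.U P - G.T (G.U P)))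
      + (P - G.T P - G.U P + G.T (G.U P) + (P - G.T P - G.U P + G.T (G.U P))) := by abel
    _ = 0 := by rw [h1, h2, h3, h4]; simp

end GData

section curve2
variable {K : Type*} [Field K] [Algebra ℚ K]

lemma E32_line {x1 y1 x2 y2 x3 l : K} (h1 : y1 ^ 2 = x1 ^ 3 - x1) (h2 : y2 ^ 2 = x2 ^ 3 - x2)
    (hl : (x1 ≠ x2 ∧ l = (y1 - y2) / (x1 - x2)) ∨
      (x1 = x2 ∧ y1 = y2 ∧ y1 ≠ 0 ∧ l = (3 * x1 ^ 2 - 1) / (2 * y1)))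
    (h3 : x3 = l ^ 2 - x1 - x2) :
    (y1 - y2 = l * (x1 - x2)) ∧
    x1 * x2 * x3 = (y1 - l * x1) ^ 2 ∧
    (x1 - 1) * (x2 - 1) * (x3 - 1) = (y1 - l * x1 + l) ^ 2 := by
  have : CharZero K := algebraRat.charZero K
  have key : (y1 - y2 = l * (x1 - x2)) ∧
      2 * y1 * l - l ^ 2 * (x1 - x2) = x1 ^ 2 + x1 * x2 + x2 ^ 2 - 1 := by
    rcases hl with ⟨hx, hl⟩ | ⟨hx, hy, hy0, hl⟩
    · have hd : x1 - x2 ≠ 0 := sub_ne_zero.2 hx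
      have e : y1 - y2 = l * (x1 - x2) := by rw [hl]; field_simp
      refine ⟨e, ?_⟩
      apply mul_right_cancel₀ hd
      have e' : y2 = y1 - l * (x1 - x2) := by linear_combination -e
      rw [e'] at h2
      linear_combination h1 - h2
    · subst hx hy
      refine ⟨by ring, ?_⟩
      rw [hl]; field_simp; ring
  obtain ⟨e, H⟩ := key
  refine ⟨e, ?_, ?_⟩
  · rw [h3]; linear_combination -h1 + x1 * H
  · rw [h3]; linear_combination -h1 - (1 - x1) * H

end curve2

namespace GData
variable {K : Type*} [Field K] [Algebra ℚ K] (G : GData K)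

lemma rho_i : G.t (G.u G.i) = - G.i := by simp [G.ui, G.ti]
lemma rho_a : G.t (G.u G.a) = - G.a := by simp [G.ua, G.ta]
lemma rho_rho (w : K) : G.t (G.u (G.t (G.u w))) = w := by rw [G.ut, G.tt, G.uu]
lemma rho_s (w : K) : G.t (G.u (G.s w)) = G.s (G.t (G.u w)) := by rw [G.us, G.ts]

lemma rho_sqrt (x c : K) (hc : G.t (G.u c) = -c) (h : x ^ 2 = c ^ 2) : G.t (G.u x) = -x := by
  rcases sq_eq_sq_iff_eq_or_eq_neg.1 h with rfl | rfl
  · exact hc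
  · simp [hc]

variable [DecidableEq K]

lemma no4 (Q : EPt K) (h4 : ((Q + G.S Q) + (Q + G.S Q)) + ((Q + G.S Q) + (Q + G.S Q)) = 0) :
    (Q + G.S Q) + (Q + G.S Q) = 0 := by
  by_contra h2
  have : CharZero K := algebraRat.charZero K
  rcases Q with _ | ⟨x1, y1, h1⟩
  · exact h2 rfl
  rw [S_some] at h4 h2
  rcases hT : (Affine.Point.some x1 y1 h1 + Affine.Point.some (G.s x1) (G.s y1)
     ((Affine.baseChange_nonsingular E32.toAffine G.s.injective ..).mpr h1)) with _ | ⟨x3, y3, h3⟩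
  · apply h2; rw [hT]; rfl
  rw [hT] at h4 h2
  have hx3 := E32_four h4 h2
  obtain ⟨l, hl, hx, -⟩ := E32_add hT
  have hE := E32_eqn h1
  have hE' : (G.s y1) ^ 2 = (G.s x1) ^ 3 - G.s x1 := by
    rw [← map_pow, hE]; simp
  obtain ⟨e, e0, e1⟩ := E32_line hE hE' hl hx
  have hsl : G.s l = l := by
    rcases hl with ⟨hx, hl⟩ | ⟨hx, hy, hy0, hl⟩
    · rw [hl]
      simp only [map_div₀, map_sub, G.ss]
      rw [← neg_sub y1, ← neg_sub x1, neg_div_neg_eq]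
    · rw [hl]
      simp [map_ofNat, ← hx, ← hy, G.s2]
  set m := y1 - l * x1 with hm
  have hsm : G.s m = m := by
    rw [hm]; simp only [map_sub, map_mul, hsl]; linear_combination -e
  have hnz : ¬ (x1 = G.s x1 ∧ y1 = 0) := by
    rintro ⟨ha, hb⟩
    rcases hl with hl | hl
    · exact hl.1 ha
    · exact hl.2.2.1 hb
  have case2 : x3 * G.t (G.u x3) = -1 → False := by
    intro hn
    have := G.norm_obstruction x1 (m * G.t (G.u m)) (by simp [hsm, ← G.rho_s])
      (by simp [G.rho_rho, mul_comm]) (by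
        have e0' := congrArg (fun v => G.t (G.u v)) e0
        simp only [map_mul, map_pow] at e0' ⊢
        linear_combination (x1 * G.s x1 * (G.t (G.u x1) * G.t (G.u (G.s x1)))) * hn - (x1 * G.s x1 * x3) * e0' - (G.t (G.u m)) ^ 2 * e0)
    subst this
    exact hnz ⟨by simp, by simpa using hE⟩
  rcases hx3 with hx3 | hx3 | hx3
  · have hr := G.rho_sqrt x3 G.i G.rho_i (by rw [hx3, G.hi])
    have hi0 := G.i0
    have ha0 := G.a0
    have h2' : (G.i * G.a) ^ 2 = -2 := by rw [mul_pow, G.hi, G.ha]; ring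
    have := G.norm_obstruction (x1 - 1) ((m + l) * G.t (G.u (m + l)) / (G.i * G.a))
      (by simp [hsm, hsl, ← G.rho_s, G.si, G.sa])
      (by simp [G.ui, G.ua, G.ti, G.ta, G.rho_rho, mul_comm]) (by
        have e1' := congrArg (fun v => G.t (G.u v)) e1
        rw [div_pow, h2']
        simp only [map_mul, map_pow, map_sub, map_one, hr] at e1' ⊢
        have e2 : (x1 - 1) * (G.s x1 - 1) * ((G.t (G.u x1) - 1) * (G.t (G.u (G.s x1)) - 1)) * 2
            = ((m + l) * G.t (G.u (m + l))) ^ 2 := by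
          linear_combination ((x1 - 1) * (G.s x1 - 1) * ((G.t (G.u x1) - 1) * (G.t (G.u (G.s x1)) - 1))) * hx3 +
            (x1 - 1) * (G.s x1 - 1) * (x3 - 1) * e1' + (G.t (G.u (m + l))) ^ 2 * e1
        rw [← e2]; ring)
    have hx1 : x1 = 1 := by linear_combination this
    subst hx1
    exact hnz ⟨by simp, by simpa using hE⟩
  · have hr := G.rho_sqrt (x3 - 1) G.a G.rho_a (by rw [hx3, G.ha])
    apply case2
    simp only [map_sub, map_one] at hr
    linear_combination -hx3 + x3 * hr
  · have hr := G.rho_sqrt (x3 + 1) G.a G.rho_a (by rw [hx3, G.ha])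
    apply case2
    simp only [map_add, map_one] at hr
    linear_combination -hx3 + x3 * hr

lemma trace2 (Q : EPt K) : (Q + G.S Q) + (Q + G.S Q) = 0 := by
  apply G.no4
  have hS : G.S (Q + G.S Q) = Q + G.S Q := by rw [map_add, G.SS, add_comm]
  have h8 := G.eight _ hS
  have := G.no4 (Q + G.S Q) (by rw [hS, ← h8]; abel)
  rwa [hS] at this

end GData

section alg
variable {K : Type*} [Field K]

lemma alg_case0 [CharZero K] {i z u w u' w' X Y X' Y' : K} (hi : i ^ 2 = -1) (hz0 : z ≠ 0)
    (hu2 : u + z ≠ 0) (hi1 : 1 + i ≠ 0)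
    (hX : X * (u - z) = i * (u + z)) (hX' : X' * (u' - z) = i * (u' + z))
    (hY : Y * (u - z) ^ 2 = (1 + i) * w) (hY' : Y' * (u' - z) ^ 2 = (1 + i) * w')
    (h1 : X' * X = -1) (h2 : Y' * X ^ 2 = -Y) : u' = -u ∧ w' = w := by
  have e1 : 2 * z * (u' + u) = 0 := by
    linear_combination (-(u - z) * (u' - z)) * h1 + X' * (u' - z) * hX + i * (u + z) * hX' + ((u + z) * (u' + z)) * hi
  have hu' : u' = -u := by
    have : u' + u = 0 := by simpa [hz0] using e1
    linear_combination this
  refine ⟨hu', ?_⟩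
  subst hu'
  have e2 : (1 + i) * (u + z) ^ 2 * (w' - w) = 0 := by
    linear_combination -(u + z) ^ 2 * hY' + (u + z) ^ 2 * hY 
      - ((u + z) ^ 2 * (u - z) ^ 2) * h2 + (u + z) ^ 2 * Y' * (X * (u - z) + i * (u + z)) * hX + Y' * (u + z) ^ 4 * hi
  have : w' - w = 0 := by simpa [hi1, hu2] using e2
  linear_combination this

lemma alg_case1 [CharZero K] {i z u w u' w' X Y X' Y' : K} (hi : i ^ 2 = -1) (hz : z ^ 2 = i) 
    (hu2 : u - i * z ≠ 0) (hi1 : 1 + i ≠ 0)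
    (hX : X * (u - z) = i * (u + z)) (hX' : X' * (u' - z) = i * (u' + z))
    (hY : Y * (u - z) ^ 2 = (1 + i) * w) (hY' : Y' * (u' - z) ^ 2 = (1 + i) * w')
    (h1 : X' * (X - 1) = X + 1) (h2 : Y' * (X - 1) ^ 2 = 2 * Y) : u * u' = -1 ∧ w' * u ^ 2 = -w := by
  have a1 : (X - 1) * (u - z) = (i - 1) * (u - i * z) := by linear_combination hX + z * hi
  have a2 : (X + 1) * (u - z) = (i + 1) * (u + i * z) := by linear_combination hX - z * hi
  have e1 : (2 * (1 + i)) * (u * u' + 1) = 0 := by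
    have k : (X' * (u' - z)) * ((X - 1) * (u - z)) = ((X + 1) * (u - z)) * (u' - z) := by
      linear_combination (u - z) * (u' - z) * h1
    rw [hX', a1, a2] at k
    linear_combination -k + ((u' + z) * (u - i * z) + 2 * (1 + i)) * hi + 2 * i * (1 + i) * hz
  have hu' : u * u' = -1 := by
    have : u * u' + 1 = 0 := by simpa [hi1] using e1
    linear_combination this
  refine ⟨hu', ?_⟩
  have b : u * (u' - z) = - z * (u - i * z) := by linear_combination hu' - i * hz - hi
  have e2 : (2 * i * (1 + i)) * (u - i * z) ^ 2 * (w' * u ^ 2 + w) = 0 := by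
    have k : (Y' * (u' - z) ^ 2) * ((X - 1) * (u - z)) ^ 2 * u ^ 2 = 2 * (Y * (u - z) ^ 2) * (u * (u' - z)) ^ 2 := by
      linear_combination (u - z) ^ 2 * (u' - z) ^ 2 * u ^ 2 * h2
    rw [hY', hY, a1, b] at k
    linear_combination -k + (1 + i) * (u - i * z) ^ 2 * (w' * u ^ 2 * hi - 2 * w * hz)
  have hi0 : i ≠ 0 := by rintro rfl; simp at hi
  have : w' * u ^ 2 + w = 0 := by simpa [hi1, hu2, hi0] using e2
  linear_combination this

lemma alg_case2 [CharZero K] {i z u w u' w' X Y X' Y' : K} (hi : i ^ 2 = -1) (hz : z ^ 2 = i) 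
    (hu2 : u + i * z ≠ 0) (hi1 : 1 + i ≠ 0)
    (hX : X * (u - z) = i * (u + z)) (hX' : X' * (u' - z) = i * (u' + z))
    (hY : Y * (u - z) ^ 2 = (1 + i) * w) (hY' : Y' * (u' - z) ^ 2 = (1 + i) * w')
    (h1 : X' * (X + 1) = 1 - X) (h2 : Y' * (X + 1) ^ 2 = 2 * Y) : u * u' = 1 ∧ w' * u ^ 2 = w := by
  have a1 : (X - 1) * (u - z) = (i - 1) * (u - i * z) := by linear_combination hX + z * hi
  have a2 : (X + 1) * (u - z) = (i + 1) * (u + i * z) := by linear_combination hX - z * hi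
  have e1 : (2 * (i - 1)) * (u * u' - 1) = 0 := by
    have k : (X' * (u' - z)) * ((X + 1) * (u - z)) = -((X - 1) * (u - z)) * (u' - z) := by
      linear_combination (u - z) * (u' - z) * h1
    rw [hX', a1, a2] at k
    linear_combination k - ((u' + z) * (u + i * z) + 2 * (i - 1)) * hi - 2 * (i - 1) * i * hz
  have hi2 : i - 1 ≠ 0 := by
    intro h
    have : i = 1 := by linear_combination h
    subst this; norm_num at hi
  have hu' : u * u' = 1 := by
    have : u * u' - 1 = 0 := by simpa [hi2] using e1
    linear_combination this
  refine ⟨hu', ?_⟩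
  have b : u * (u' - z) = - z * (u + i * z) := by linear_combination hu' + i * hz + hi
  have e2 : (2 * i * (1 + i)) * (u + i * z) ^ 2 * (w' * u ^ 2 - w) = 0 := by
    have k : (Y' * (u' - z) ^ 2) * ((X + 1) * (u - z)) ^ 2 * u ^ 2 = 2 * (Y * (u - z) ^ 2) * (u * (u' - z)) ^ 2 := by
      linear_combination (u - z) ^ 2 * (u' - z) ^ 2 * u ^ 2 * h2
    rw [hY', hY, a2, b] at k
    linear_combination k - (1 + i) * (u + i * z) ^ 2 * (w' * u ^ 2 * hi - 2 * w * hz)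
  have hi0 : i ≠ 0 := by rintro rfl; simp at hi
  have : w' * u ^ 2 - w = 0 := by simpa [hi1, hu2, hi0] using e2
  linear_combination this

end alg

namespace GData
variable {K : Type*} [Field K] [Algebra ℚ K] (G : GData K)

/-- a primitive eighth root of unity -/
noncomputable def z : K := G.a * (1 + G.i) / 2

lemma z_sq : G.z ^ 2 = G.i := by
  have : CharZero K := algebraRat.charZero K
  unfold z
  rw [div_pow, mul_pow, G.ha]
  field_simp
  linear_combination G.hi

lemma z4 : G.z ^ 4 = -1 := by
  linear_combination (G.z ^ 2 + G.i) * G.z_sq + G.hi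

lemma sz : G.s G.z = G.z := by
  unfold z; simp [G.sa, G.si, G.s2]

variable [DecidableEq K]

lemma lemC {u w : K} (hw : w ≠ 0) (h : w ^ 2 = -(u ^ 4 + 1)) :
    (G.s u = u ∧ G.s w = -w) ∨ (G.s u = -u ∧ G.s w = w) ∨
    (u * G.s u = 1 ∧ G.s w * u ^ 2 = w) ∨ (u * G.s u = -1 ∧ G.s w * u ^ 2 = -w) := by
  have : CharZero K := algebraRat.charZero K
  have hi := G.hi
  have hz := G.z_sq
  have hz4 := G.z4
  have hsz := G.sz
  have hsi := G.si
  set z := G.z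
  set i := G.i
  have hi0 : i ≠ 0 := G.i0
  have hz0 : z ≠ 0 := by intro h; simp [h] at hz4
  have hu4 : u ^ 4 + 1 ≠ 0 := by
    intro h'; rw [h'] at h; simp at h; exact hw h
  have hi1 : 1 + i ≠ 0 := by
    intro h
    have : i = -1 := by linear_combination h
    rw [this] at hi; norm_num at hi
  have hfac : u ^ 4 + 1 = (u - z) * (u + z) * (u - i * z) * (u + i * z) := by
    linear_combination (u ^ 2 * z ^ 2 - z ^ 4) * hi + hz4
  rw [hfac] at hu4
  have hd : u - z ≠ 0 := fun h => hu4 (by simp [h])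
  have hd1 : u + z ≠ 0 := fun h => hu4 (by simp [h])
  have hd2 : u - i * z ≠ 0 := fun h => hu4 (by simp [h])
  have hd3 : u + i * z ≠ 0 := fun h => hu4 (by simp [h])
  obtain ⟨X, hXd⟩ : ∃ X, X = i * (u + z) / (u - z) := ⟨_, rfl⟩
  obtain ⟨Y, hYd⟩ : ∃ Y, Y = (1 + i) * w / (u - z) ^ 2 := ⟨_, rfl⟩
  have hX : X * (u - z) = i * (u + z) := by rw [hXd]; field_simp
  have hY : Y * (u - z) ^ 2 = (1 + i) * w := by rw [hYd]; field_simp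
  have hX' : G.s X * (G.s u - z) = i * (G.s u + z) := by
    have := congrArg G.s hX
    simpa [hsz, hsi] using this
  have hY' : G.s Y * (G.s u - z) ^ 2 = (1 + i) * G.s w := by
    have := congrArg G.s hY
    simpa [hsz, hsi] using this
  have hE : Y ^ 2 = X ^ 3 - X := by
    have h4 : (u - z) ^ 4 ≠ 0 := pow_ne_zero _ hd
    apply mul_right_cancel₀ h4
    have l : Y ^ 2 * (u - z) ^ 4 = (1 + i) ^ 2 * w ^ 2 := by
      rw [← mul_pow, ← hY]; ring
    have r : (X ^ 3 - X) * (u - z) ^ 4 = (i * (u + z)) ^ 3 * (u - z) - (i * (u + z)) * (u - z) ^ 3 := by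
      rw [← hX]; ring
    rw [l, r, h]
    linear_combination (-(u ^ 4 + 1) - i * (u + z) ^ 3 * (u - z)) * hi - 2 * i * hz4
  have hQ := G.trace2 (Affine.Point.some X Y (E32_ns hE))
  rw [S_some] at hQ
  rcases hT : (Affine.Point.some X Y (E32_ns hE) + Affine.Point.some (G.s X) (G.s Y)
     ((Affine.baseChange_nonsingular E32.toAffine G.s.injective ..).mpr (E32_ns hE)))
     with _ | ⟨e, f, h3⟩
  · left
    obtain ⟨h1, h2⟩ := E32_add_eq_zero hT
    rw [h1] at hX'
    rw [h2] at hY'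
    have e1 : 2 * i * z * (G.s u - u) = 0 := by
      linear_combination -(G.s u - z) * hX + (u - z) * hX'
    have e2 : G.s u - u = 0 := by simpa [hi0, hz0] using e1
    have e3 : G.s u = u := by linear_combination e2
    refine ⟨e3, ?_⟩
    rw [e3] at hY'
    apply mul_left_cancel₀ hi1
    linear_combination -hY' - hY
  right
  rw [hT] at hQ
  have hf := E32_double_zero.1 hQ
  subst hf
  have he := E32_eqn h3
  have hT2 : Affine.Point.some e 0 h3 + -(Affine.Point.some X Y (E32_ns hE)) =
      Affine.Point.some (G.s X) (G.s Y)
     ((Affine.baseChange_nonsingular E32.toAffine G.s.injective ..).mpr (E32_ns hE)) := by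
    rw [← hT]; abel
  rw [E32_neg] at hT2
  obtain ⟨l, hl, hx, hy⟩ := E32_add hT2
  rcases hl with ⟨hne, hl⟩ | hl
  swap
  · exact absurd rfl hl.2.2.1
  have hne' : e - X ≠ 0 := sub_ne_zero.2 hne
  have hl : l * (e - X) = Y := by rw [hl]; field_simp; ring
  have hc : e = 0 ∨ e = 1 ∨ e = -1 := by
    have : e * ((e - 1) * (e + 1)) = 0 := by linear_combination -he
    simp only [mul_eq_zero] at this
    grind
  clear he h3 hT hT2 hQ
  have k1 : G.s X * (e - X) ^ 2 = Y ^ 2 - (e + X) * (e - X) ^ 2 := by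
    rw [hx, ← hl]; ring
  have k2 : G.s Y * (e - X) ^ 3 = - (Y * (G.s X * (e - X) ^ 2 - e * (e - X) ^ 2)) := by
    rw [hy, ← hl]; ring
  rw [k1, hE] at k2
  rw [hE] at k1
  rcases hc with rfl | rfl | rfl
  · left
    apply alg_case0 hi hz0 hd1 hi1 hX hX' hY hY'
    · apply mul_right_cancel₀ hne'; linear_combination -k1
    · apply mul_right_cancel₀ hne'; linear_combination k2
  · right; right
    apply alg_case1 hi hz hd2 hi1 hX hX' hY hY'
    · apply mul_right_cancel₀ hne'; linear_combination -k1
    · apply mul_right_cancel₀ hne'; linear_combination k2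
  · right; left
    apply alg_case2 hi hz hd3 hi1 hX hX' hY hY'
    · apply mul_right_cancel₀ hne'; linear_combination -k1
    · apply mul_right_cancel₀ hne'; linear_combination k2

end GData

namespace GData
variable {K : Type*} [Field K] [Algebra ℚ K] (G : GData K)

lemma no_v4 (G : GData K) {v : K} (h : v ^ 4 = -2) : False := by
  have : CharZero K := algebraRat.charZero K
  have hv : v ≠ 0 := by rintro rfl; norm_num at h
  have hi := G.hi
  have h1 : (v ^ 2) ^ 2 = (G.i * G.a) ^ 2 := by
    rw [mul_pow, G.hi, G.ha]; linear_combination h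
  have h2 : v ^ 2 = G.i * G.a ∨ v ^ 2 = -(G.i * G.a) := sq_eq_sq_iff_eq_or_eq_neg.1 h1
  have ht : G.t v ^ 2 = (G.i * v) ^ 2 := by
    rw [← map_pow, mul_pow, hi]
    rcases h2 with h2 | h2 <;> rw [h2] <;> simp [G.ti, G.ta]
  have hu : G.u v ^ 2 = (G.i * v) ^ 2 := by
    rw [← map_pow, mul_pow, hi]
    rcases h2 with h2 | h2 <;> rw [h2] <;> simp [G.ui, G.ua]
  have hc := G.ut v
  have key : ∀ w : K, w ^ 2 = v ^ 2 → w = - w → False := by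
    intro w hw hww
    have : (2:K) * w = 0 := by linear_combination hww
    have : w = 0 := by simpa using this
    rw [this] at hw; exact hv (by simpa using hw.symm)
  rcases sq_eq_sq_iff_eq_or_eq_neg.1 ht with ht | ht <;>
  rcases sq_eq_sq_iff_eq_or_eq_neg.1 hu with hu | hu <;>
  · rw [ht, hu] at hc
    simp only [map_mul, map_neg, ht, hu, G.ui, G.ti] at hc
    apply key v rfl
    first
    | linear_combination hc + 2 * v * hi
    | linear_combination -hc + 2 * v * hi

variable [DecidableEq K]

lemma lemT {r p : K} (hp : p ≠ 0) (h : p ^ 4 * (r ^ 4 + 1) = -1) :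
    (G.s r = r ∧ G.s p ^ 2 = - p ^ 2) ∨ (G.s r = -r ∧ G.s p ^ 2 = p ^ 2) ∨
    (r * G.s r = 1 ∧ G.s p ^ 2 = r ^ 2 * p ^ 2) ∨
    (r * G.s r = -1 ∧ G.s p ^ 2 = - r ^ 2 * p ^ 2) := by
  have hsp : G.s p ≠ 0 := by simpa using hp
  have := G.lemC (u := r) (w := (p ^ 2)⁻¹) (by simpa using hp) (by
    field_simp; linear_combination h)
  simp only [map_inv₀, map_pow] at this
  rcases this with ⟨h1, h2⟩ | ⟨h1, h2⟩ | ⟨h1, h2⟩ | ⟨h1, h2⟩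
  · left; refine ⟨h1, ?_⟩
    field_simp at h2; linear_combination h2
  · right; left; refine ⟨h1, ?_⟩
    field_simp at h2; linear_combination -h2
  · right; right; left; refine ⟨h1, ?_⟩
    field_simp at h2; linear_combination -h2
  · right; right; right; refine ⟨h1, ?_⟩
    field_simp at h2; linear_combination h2

lemma step {r p q : K} (hr : r ≠ 0) (hp : p ≠ 0) (hq : q ≠ 0) (h : p ^ 4 * (r ^ 4 + 1) = -1)
    (h' : q ^ 4 * (p ^ 4 + 1) = -1) : G.s r = -r ∨ r ^ 8 + r ^ 4 + 1 = 0 := by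
  have : CharZero K := algebraRat.charZero K
  have hp2 : G.s p ^ 2 = p ^ 2 ∨ p ^ 2 * G.s p ^ 2 = 1 := by
    rcases G.lemT hq h' with ⟨h1, -⟩ | ⟨h1, -⟩ | ⟨h1, -⟩ | ⟨h1, -⟩
    · left; rw [h1]
    · left; rw [h1]; ring
    · right; rw [← mul_pow, h1]; ring
    · right; rw [← mul_pow, h1]; ring
  have hp0 : p ^ 2 ≠ 0 := pow_ne_zero _ hp
  have hno : ¬ (r ^ 4 = 1) := by
    intro h4
    apply G.no_v4 (v := p⁻¹)
    rw [h4] at h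
    field_simp
    linear_combination h
  rcases G.lemT hp h with ⟨-, h2⟩ | ⟨h1, -⟩ | ⟨-, h2⟩ | ⟨-, h2⟩
  · exfalso
    rw [h2] at hp2
    rcases hp2 with h3 | h3
    · have : (2:K) * p ^ 2 = 0 := by linear_combination -h3
      simp [hp] at this
    · have h4 : p ^ 4 = -1 := by linear_combination -h3
      rw [h4] at h
      have : r ^ 4 = 0 := by linear_combination -h
      simp [hr] at this
  · left; exact h1
  · right
    rw [h2] at hp2
    rcases hp2 with h3 | h3
    · exfalso; apply hno
      have : r ^ 2 = 1 := by apply mul_right_cancel₀ hp0; linear_combination h3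
      linear_combination (r ^ 2 + 1) * this
    · have : r ^ 4 + 1 + r ^ 2 = 0 := by linear_combination -(r ^ 4 + 1) * h3 + r ^ 2 * h
      linear_combination (r ^ 4 + 1 - r ^ 2) * this
  · right
    rw [h2] at hp2
    rcases hp2 with h3 | h3
    · exfalso; apply hno
      have : r ^ 2 = -1 := by apply mul_right_cancel₀ hp0; linear_combination -h3
      linear_combination (r ^ 2 - 1) * this
    · have : r ^ 4 + 1 - r ^ 2 = 0 := by linear_combination -(r ^ 4 + 1) * h3 - r ^ 2 * h
      linear_combination (r ^ 4 + 1 + r ^ 2) * this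

lemma main (G : GData K) {x y : K} (hx : x ≠ 0) (hy : y ≠ 0) (h : x ^ 4 + y ^ 4 = 1) :
    x ^ 8 - x ^ 4 + 1 = 0 := by
  have : CharZero K := algebraRat.charZero K
  have hz4 := G.z4
  set z := G.z
  have hz0 : z ≠ 0 := by intro h; simp [h] at hz4
  have r0 : x / y ≠ 0 := div_ne_zero hx hy
  have p0 : y / z ≠ 0 := div_ne_zero hy hz0
  have q0 : z / x ≠ 0 := div_ne_zero hz0 hx
  have e1 : (y / z) ^ 4 * ((x / y) ^ 4 + 1) = -1 := by
    field_simp; linear_combination h + hz4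
  have e2 : (z / x) ^ 4 * ((y / z) ^ 4 + 1) = -1 := by
    field_simp; linear_combination h + hz4
  have e3 : (x / y) ^ 4 * ((z / x) ^ 4 + 1) = -1 := by
    field_simp; linear_combination h + hz4
  rcases G.step r0 p0 q0 e1 e2 with h1 | h1
  · rcases G.step p0 q0 r0 e2 e3 with h2 | h2
    · rcases G.step q0 r0 p0 e3 e1 with h3 | h3
      · exfalso
        have hprod : (x / y) * (y / z) * (z / x) = 1 := by field_simp
        have hs := congrArg G.s hprod
        rw [map_mul, map_mul, h1, h2, h3, map_one] at hs
        have : (2:K) = 0 := by linear_combination -hs - hprod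
        norm_num at this
      · field_simp at h3
        linear_combination h3 - (z ^ 4 + x ^ 4 - 1) * hz4
    · field_simp at h2
      have hyx : y ^ 4 = 1 - x ^ 4 := by linear_combination h
      linear_combination h2 - (z ^ 4 + y ^ 4 - 1) * hz4 - (y ^ 4 - x ^ 4) * hyx
  · field_simp at h1
    have hyx : y ^ 4 = 1 - x ^ 4 := by linear_combination h
    linear_combination h1 - (y ^ 4 + 1) * hyx

end GData

section cyc

/-- the field -/
abbrev K24 := CyclotomicField 24 ℚ

instance inst24 : IsCyclotomicExtension {24} ℚ K24 := by
  have : NeZero ((24 : ℕ) : ℚ) := ⟨by norm_num⟩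
  exact CyclotomicField.isCyclotomicExtension 24 ℚ

/-- the chosen root of unity -/
noncomputable def zt : K24 := IsCyclotomicExtension.zeta 24 ℚ K24

lemma zt_prim : IsPrimitiveRoot zt 24 := IsCyclotomicExtension.zeta_spec 24 ℚ K24

lemma zt_rel : zt ^ 8 - zt ^ 4 + 1 = 0 := by
  have h24 := zt_prim.pow_eq_one
  have h12 : zt ^ 12 - 1 ≠ 0 := fun h => by
    have := zt_prim.dvd_of_pow_eq_one 12 (by linear_combination h)
    omega
  have h8 : zt ^ 8 - 1 ≠ 0 := fun h => by
    have := zt_prim.dvd_of_pow_eq_one 8 (by linear_combination h)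
    omega
  have h4 : zt ^ 4 + 1 ≠ 0 := fun h => h8 (by linear_combination (zt ^ 4 - 1) * h)
  have e : (zt ^ 12 - 1) * ((zt ^ 4 + 1) * (zt ^ 8 - zt ^ 4 + 1)) = 0 := by linear_combination h24
  simpa [h12, h4] using e

lemma zt12 : zt ^ 12 = -1 := by linear_combination (zt ^ 4 + 1) * zt_rel

lemma irr24 : Irreducible (Polynomial.cyclotomic 24 ℚ) := Polynomial.cyclotomic.irreducible_rat (by norm_num)

/-- the automorphism with `zt ↦ zt ^ k` -/
noncomputable def aut (k : ℕ) (hk : Nat.Coprime k 24) : K24 →ₐ[ℚ] K24 :=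
  (IsCyclotomicExtension.fromZetaAut (zt_prim.pow_of_coprime k hk) irr24 : K24 ≃ₐ[ℚ] K24)

lemma aut_zt (k : ℕ) (hk : Nat.Coprime k 24) : aut k hk zt = zt ^ k :=
  IsCyclotomicExtension.fromZetaAut_spec _ _

lemma hom_ext {f g : K24 →ₐ[ℚ] K24} (h : f zt = g zt) : f = g :=
  (zt_prim.powerBasis ℚ).algHom_ext (by simpa using h)

lemma zt_mod (m n : ℕ) (h : m % 24 = n % 24) : zt ^ m = zt ^ n := by
  rw [← pow_mod_orderOf, ← pow_mod_orderOf zt n, ← zt_prim.eq_orderOf, h]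

lemma aut_comp (j k l : ℕ) (hj : Nat.Coprime j 24) (hk : Nat.Coprime k 24) (hl : Nat.Coprime l 24)
    (h : (j * k) % 24 = l % 24) (x : K24) : aut j hj (aut k hk x) = aut l hl x := by
  have : (aut j hj).comp (aut k hk) = aut l hl := by
    apply hom_ext
    simp only [AlgHom.comp_apply, aut_zt, map_pow, ← pow_mul]
    exact zt_mod _ _ h
  exact congrArg (fun f => f x) this

lemma aut_one (hj : Nat.Coprime 1 24) (x : K24) : aut 1 hj x = x := by
  have : aut 1 hj = AlgHom.id ℚ K24 := hom_ext (by simp [aut_zt])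
  rw [this]; rfl

lemma aut_fix (x : K24) (h : ∀ k hk, aut k hk x = x) : ∃ q : ℚ, x = algebraMap ℚ K24 q := by
  have : IsGalois ℚ K24 := IsCyclotomicExtension.isGalois {24} ℚ K24
  have := (IsGalois.mem_range_algebraMap_iff_fixed (F := ℚ) x).2 (fun f => by
    have h1 : IsPrimitiveRoot (f zt) 24 := zt_prim.map_of_injective f.injective
    obtain ⟨k, -, hk, e⟩ := zt_prim.isPrimitiveRoot_iff.1 h1
    have : (f : K24 →ₐ[ℚ] K24) = aut k hk := hom_ext (by rw [aut_zt, e]; rfl)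
    have h2 := congrArg (fun g : K24 →ₐ[ℚ] K24 => g x) this
    rw [h k hk] at h2
    exact h2)
  obtain ⟨q, hq⟩ := this
  exact ⟨q, hq.symm⟩

noncomputable def G24 : GData K24 where
  s := aut 17 (by norm_num)
  t := aut 23 (by norm_num)
  u := aut 13 (by norm_num)
  ss x := by rw [aut_comp 17 17 1 _ _ (by norm_num) (by norm_num), aut_one]
  tt x := by rw [aut_comp 23 23 1 _ _ (by norm_num) (by norm_num), aut_one]
  uu x := by rw [aut_comp 13 13 1 _ _ (by norm_num) (by norm_num), aut_one]
  ts x := by rw [aut_comp 23 17 7 _ _ (by norm_num) (by norm_num), aut_comp 17 23 7 _ _ (by norm_num) (by norm_num)]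
  us x := by rw [aut_comp 13 17 5 _ _ (by norm_num) (by norm_num), aut_comp 17 13 5 _ _ (by norm_num) (by norm_num)]
  ut x := by rw [aut_comp 13 23 11 _ _ (by norm_num) (by norm_num), aut_comp 23 13 11 _ _ (by norm_num) (by norm_num)]
  i := zt ^ 6
  a := zt ^ 3 + zt ^ 21
  b := zt ^ 2 + zt ^ 22
  hi := by linear_combination zt12
  ha := by
    have h := zt12
    have r := zt_rel
    have e21 : zt ^ 21 = - zt ^ 9 := by linear_combination zt ^ 9 * h
    rw [e21]
    linear_combination zt ^ 6 * (1 + 0) * h - 2 * h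
  hb := by
    have h := zt12
    have r := zt_rel
    have e22 : zt ^ 22 = - zt ^ 10 := by linear_combination zt ^ 10 * h
    rw [e22]
    linear_combination zt ^ 8 * h - 2 * h - r
  si := by
    simp only [map_pow, aut_zt, ← pow_mul]
    exact zt_mod _ _ (by norm_num)
  ti := by
    have h := zt12
    simp only [map_pow, aut_zt, ← pow_mul]
    rw [zt_mod (23 * 6) 18 (by norm_num)]
    linear_combination zt ^ 6 * h
  ui := by
    simp only [map_pow, aut_zt, ← pow_mul]
    exact zt_mod _ _ (by norm_num)
  sa := by
    simp only [map_add, map_pow, aut_zt, ← pow_mul]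
    rw [zt_mod (17 * 3) 3 (by norm_num), zt_mod (17 * 21) 21 (by norm_num)]
  ta := by
    simp only [map_add, map_pow, aut_zt, ← pow_mul]
    rw [zt_mod (23 * 3) 21 (by norm_num), zt_mod (23 * 21) 3 (by norm_num), add_comm]
  ua := by
    have h := zt12
    simp only [map_add, map_pow, aut_zt, ← pow_mul]
    rw [zt_mod (13 * 3) 15 (by norm_num), zt_mod (13 * 21) 9 (by norm_num)]
    linear_combination (zt ^ 3 + zt ^ 9) * h
  sb := by
    have h := zt12
    simp only [map_add, map_pow, aut_zt, ← pow_mul]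
    rw [zt_mod (17 * 2) 10 (by norm_num), zt_mod (17 * 22) 14 (by norm_num)]
    linear_combination (zt ^ 2 + zt ^ 10) * h
  tb := by
    simp only [map_add, map_pow, aut_zt, ← pow_mul]
    rw [zt_mod (23 * 2) 22 (by norm_num), zt_mod (23 * 22) 2 (by norm_num), add_comm]
  ub := by
    simp only [map_add, map_pow, aut_zt, ← pow_mul]
    rw [zt_mod (13 * 2) 2 (by norm_num), zt_mod (13 * 22) 22 (by norm_num)]
  fix x h1 h2 h3 := by
    apply aut_fix
    intro k hk
    have h0 := aut_one (by norm_num) x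
    have h4 : aut 7 (by norm_num) x = x := by
      rw [← aut_comp 17 23 7 (by norm_num) (by norm_num) _ (by norm_num), h2, h1]
    have h5 : aut 5 (by norm_num) x = x := by
      rw [← aut_comp 17 13 5 (by norm_num) (by norm_num) _ (by norm_num), h3, h1]
    have h6 : aut 11 (by norm_num) x = x := by
      rw [← aut_comp 23 13 11 (by norm_num) (by norm_num) _ (by norm_num), h3, h2]
    have h7 : aut 19 (by norm_num) x = x := by
      rw [← aut_comp 17 11 19 (by norm_num) (by norm_num) _ (by norm_num), h6, h1]
    have red : ∀ m (hm : Nat.Coprime m 24), m % 24 = k % 24 → aut m hm x = x → aut k hk x = x := by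
      intro m hm hmk hx
      have : aut k hk = aut m hm := hom_ext (by rw [aut_zt, aut_zt]; exact zt_mod _ _ hmk.symm)
      rw [this, hx]
    have hk' : Nat.Coprime (k % 24) 24 := by
      have : Nat.gcd (k % 24) 24 = Nat.gcd k 24 := Nat.ModEq.gcd_eq (Nat.mod_modEq k 24)
      rw [Nat.Coprime, this]; exact hk
    have hlt : k % 24 < 24 := Nat.mod_lt _ (by norm_num)
    have hcase : k % 24 = 1 ∨ k % 24 = 5 ∨ k % 24 = 7 ∨ k % 24 = 11 ∨ k % 24 = 13 ∨ k % 24 = 17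
        ∨ k % 24 = 19 ∨ k % 24 = 23 := by
      generalize k % 24 = m at hk' hlt
      interval_cases m <;> first | omega | (revert hk'; decide)
    rcases hcase with h | h | h | h | h | h | h | h
    · exact red 1 _ h.symm h0
    · exact red 5 _ h.symm h5
    · exact red 7 _ h.symm h4
    · exact red 11 _ h.symm h6
    · exact red 13 _ h.symm h3
    · exact red 17 _ h.symm h1
    · exact red 19 _ h.symm h7
    · exact red 23 _ h.symm h2

end cyc

section count

/-- encoding of `0` and the powers of `zt` -/
noncomputable def enc (m : ℕ) : K24 := if m = 24 then 0 else zt ^ m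

lemma enc_lt {m : ℕ} (h : m < 24) : enc m = zt ^ m := by
  unfold enc; rw [if_neg (by omega)]

lemma enc_24 : enc 24 = 0 := by simp [enc]

lemma zt_ne : zt ≠ 0 := zt_prim.ne_zero (by norm_num)

lemma zt_pow_eq {m n : ℕ} : zt ^ m = zt ^ n ↔ m % 24 = n % 24 := by
  refine ⟨fun h => ?_, zt_mod m n⟩
  rw [zt_mod m (m % 24) (by omega), zt_mod n (n % 24) (by omega)] at h
  exact zt_prim.pow_inj (by omega) (by omega) h

lemma enc_inj {m n : ℕ} (hm : m < 25) (hn : n < 25) (h : enc m = enc n) : m = n := by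
  unfold enc at h
  have := zt_ne
  split_ifs at h with h1 h2 h2
  · omega
  · exact absurd h.symm (pow_ne_zero _ zt_ne)
  · exact absurd h (pow_ne_zero _ zt_ne)
  · rw [zt_pow_eq] at h; omega

/-- exponents of the points -/
def expo : Finset (ℕ × ℕ) := (Finset.range 25 ×ˢ Finset.range 25).filter fun p =>
  (p.1 = 24 ∧ p.2 < 24 ∧ p.2 % 6 = 0) ∨ (p.2 = 24 ∧ p.1 < 24 ∧ p.1 % 6 = 0) ∨
  (p.1 < 24 ∧ p.2 < 24 ∧ p.1 % 2 ≠ 0 ∧ p.1 % 3 ≠ 0 ∧ p.2 % 6 = (5 * p.1) % 6)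

lemma expo_card : expo.card = 40 := by decide +kernel

lemma exists_pow {x : K24} (h : x ^ 24 = 1) : ∃ m < 24, x = zt ^ m := by
  obtain ⟨m, hm, e⟩ := zt_prim.eq_pow_of_pow_eq_one h
  exact ⟨m, hm, e.symm⟩

lemma pow4 {x : K24} (h : x ^ 4 = 1) : ∃ m < 24, m % 6 = 0 ∧ x = zt ^ m := by
  obtain ⟨m, hm, rfl⟩ := exists_pow (x := x) (by linear_combination (x ^ 20 + x ^ 16 + x ^ 12 + x ^ 8 + x ^ 4 + 1) * h)
  refine ⟨m, hm, ?_, rfl⟩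
  rw [← pow_mul, ← pow_zero zt, zt_pow_eq] at h
  omega

lemma set_eq : {p : K24 × K24 | p.1 ^ 4 + p.2 ^ 4 = 1} =
    (fun p : ℕ × ℕ => (enc p.1, enc p.2)) '' (expo : Set (ℕ × ℕ)) := by
  classical
  ext ⟨x, y⟩
  simp only [Set.mem_ofPred_eq, Set.mem_image, Finset.mem_coe, Prod.exists, Prod.mk.injEq]
  constructor
  · intro h
    by_cases hx : x = 0
    · subst hx
      obtain ⟨m, hm, h6, rfl⟩ := pow4 (x := y) (by linear_combination h)
      refine ⟨24, m, ?_, enc_24, enc_lt hm⟩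
      simp [expo]; omega
    by_cases hy : y = 0
    · subst hy
      obtain ⟨m, hm, h6, rfl⟩ := pow4 (x := x) (by linear_combination h)
      refine ⟨m, 24, ?_, enc_lt hm, enc_24⟩
      simp [expo]; omega
    have hr := G24.main hx hy h
    have h12 : x ^ 12 = -1 := by linear_combination (x ^ 4 + 1) * hr
    have hy4 : y ^ 4 = x ^ 20 := by linear_combination h - x ^ 8 * h12 + hr
    have hx24 : x ^ 24 = 1 := by linear_combination (x ^ 12 - 1) * h12
    obtain ⟨m, hm, rfl⟩ := exists_pow hx24
    obtain ⟨n, hn, rfl⟩ := exists_pow (x := y) (by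
      rw [show y ^ 24 = (y ^ 4) ^ 6 by ring, hy4, ← pow_mul, show 20 * 6 = 24 * 5 by norm_num, pow_mul, hx24, one_pow])
    refine ⟨m, n, ?_, enc_lt hm, enc_lt hn⟩
    rw [← pow_mul, ← pow_mul, zt_pow_eq] at hy4
    have a1 : m % 2 ≠ 0 := by
      intro h2
      have : (zt ^ m) ^ 12 = 1 := by
        rw [← pow_mul, ← pow_zero zt, zt_pow_eq]; omega
      rw [this] at h12
      norm_num at h12
    have a2 : m % 3 ≠ 0 := by
      intro h2
      have h8 : (zt ^ m) ^ 8 = 1 := by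
        rw [← pow_mul, ← pow_zero zt, zt_pow_eq]; omega
      have h4 : (zt ^ m) ^ 4 = 2 := by linear_combination h8 - hr
      have : (4 : K24) = 1 := by linear_combination h8 - ((zt ^ m) ^ 4 + 2) * h4
      norm_num at this
    simp [expo]; omega
  · rintro ⟨m, n, h, rfl, rfl⟩
    simp only [expo, Finset.mem_filter] at h
    rcases h.2 with ⟨h1, h2, h3⟩ | ⟨h1, h2, h3⟩ | ⟨h1, h2, h3, h4, h5⟩
    · rw [h1, enc_24, enc_lt h2, ← pow_mul, zt_mod (n * 4) 0 (by omega)]; norm_num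
    · rw [h1, enc_24, enc_lt h2, ← pow_mul, zt_mod (m * 4) 0 (by omega)]; norm_num
    · rw [enc_lt h1, enc_lt h2, ← pow_mul zt n, zt_mod (n * 4) (m * 20) (by omega), pow_mul]
      have h12 : (zt ^ m) ^ 12 = -1 := by
        rw [← pow_mul, mul_comm, pow_mul, zt12]
        exact Odd.neg_one_pow (Nat.odd_iff.2 (by omega))
      have h8 : (zt ^ m) ^ 4 + 1 ≠ 0 := by
        intro h
        have : zt ^ (m * 8) = zt ^ 0 := by
          rw [pow_mul]; linear_combination ((zt ^ m) ^ 4 - 1) * h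
        rw [zt_pow_eq] at this
        omega
      have hr : (zt ^ m) ^ 8 - (zt ^ m) ^ 4 + 1 = 0 := by
        apply mul_left_cancel₀ h8
        linear_combination h12
      linear_combination (zt ^ m) ^ 8 * h12 - hr

end count

/-- Let `K₂ = ℚ(ζ₂₄)` be the 24-th cyclotomic field (which equals `ℚ(ζ₃, ζ₈)`).
Then the Fermat quartic `x⁴ + y⁴ = 1` has exactly 40 affine points with
coordinates in `K₂`. -/
theorem fermat_quartic_affine_points_cyclotomic_twentyfour :
    {p : CyclotomicField 24 ℚ × CyclotomicField 24 ℚ |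
      p.1 ^ 4 + p.2 ^ 4 = 1}.ncard = 40 := by
  have h := set_eq
  rw [h, Set.InjOn.ncard_image, Set.ncard_coe_finset, expo_card]
  rintro ⟨a, b⟩ h1 ⟨c, d⟩ h2 h3
  simp only [expo, Finset.coe_filter, Set.mem_ofPred_eq, Finset.mem_product, Finset.mem_range] at h1 h2
  simp only [Prod.mk.injEq] at h3 ⊢
  exact ⟨enc_inj h1.1.1 h2.1.1 h3.1, enc_inj h1.1.2 h2.1.2 h3.2⟩
end
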